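/- Let A_S be an Artin group of large type. Then the intersection of any two parabolic subgroups of A_S is again a parabolic subgroup of A_S. -/

import Mathlib

/-- The alternating word `sts⋯` of length `k` in the free group on `S`. -/
def braidWord {S : Type*} (k : ℕ) (s t : S) : FreeGroup S :=
  ((List.range k).map fun i => FreeGroup.of (if i % 2 = 0 then s else t)).prod

/-- The braid relations of the Artin group with Coxeter-type matrix `M`
(`M s t = ⊤` means no relation). -/
def artinRels {S : Type*} (M : S → S → ℕ∞) : Set (FreeGroup S) :=
  { r | ∃ s t : S, s ≠ t ∧ ∃ k : ℕ, M s t = (k : ℕ∞) ∧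
      r = braidWord k s t * (braidWord k t s)⁻¹ }

/-- The Artin group associated to the matrix `M`. -/
abbrev ArtinGroup {S : Type*} (M : S → S → ℕ∞) : Type _ := PresentedGroup (artinRels M)

/-- The standard parabolic subgroup `A_X` generated by the images of elements of `X ⊆ S`. -/
def StandardParabolic {S : Type*} (M : S → S → ℕ∞) (X : Set S) : Subgroup (ArtinGroup M) :=
  Subgroup.closure ((fun s => (PresentedGroup.of s : ArtinGroup M)) '' X)

/-- The conjugate `g H g⁻¹` of a subgroup. -/
def conjSubgroup {G : Type*} [Group G] (g : G) (H : Subgroup G) : Subgroup G :=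
  H.map (MulAut.conj g).toMonoidHom

/-- A parabolic subgroup: a conjugate of a standard parabolic subgroup. -/
def IsParabolic {S : Type*} (M : S → S → ℕ∞) (P : Subgroup (ArtinGroup M)) : Prop :=
  ∃ (g : ArtinGroup M) (X : Set S), P = conjSubgroup g (StandardParabolic M X)

universe u v

/-- The injectivity and girth conditions on a triangle of groups with vertex groups `G i`, edge
groups `E k` (the group `E k` sits on the edge joining the two vertices different from `k`) and
trivial face group: in each vertex group the coset graph of the two edge groups contains no
circuit of length at most four. -/
structure TriHyp {G E : Fin 3 → Type u} [∀ i, Group (G i)] [∀ i, Group (E i)]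
    (f : ∀ i k, E k →* G i) : Prop where
  inj : ∀ i k, i ≠ k → Function.Injective (f i k)
  link : ∀ i j k, i ≠ j → i ≠ k → j ≠ k → ∀ (p p' : E j) (q q' : E k),
    f i j p * f i k q = f i k q' * f i j p' → p = 1 ∨ q = 1

/-- The vertices of the development: normal forms of directed geodesics issued from a base
vertex of colour `i₀`. -/
inductive TriVertex (G E : Fin 3 → Type u) (i₀ : Fin 3) : Fin 3 → Type u
  | root : TriVertex G E i₀ i₀
  | one {i : Fin 3} (j : Fin 3) (u : TriVertex G E i₀ i) (r : G i) : TriVertex G E i₀ j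
  | two {i : Fin 3} (u : TriVertex G E i₀ i) (h : G i) (e : E i) : TriVertex G E i₀ i

namespace TriVertex

variable {G E : Fin 3 → Type u} [∀ i, Group (G i)] [∀ i, Group (E i)] {i₀ : Fin 3}
  (f : ∀ i k, E k →* G i)

/-- The colour different from two given distinct colours. -/
def third (i j : Fin 3) : Fin 3 := -(i + j)

theorem eq_third {i j k : Fin 3} (hij : i ≠ j) (hik : i ≠ k) (hjk : j ≠ k) : third i j = k := by
  revert i j k; unfold third; decide

theorem third_ne {i j : Fin 3} (hij : i ≠ j) : i ≠ third i j ∧ j ≠ third i j := by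
  revert i j; unfold third; decide

theorem eq_or_eq_or_eq {i j k : Fin 3} (hij : i ≠ j) (hik : i ≠ k) (hjk : j ≠ k) (l : Fin 3) :
    l = i ∨ l = j ∨ l = k := by
  revert i j k l; decide

/-- A representative of the coset of `g` modulo the edge group `E k`. -/
noncomputable def rep (i k : Fin 3) (g : G i) : G i :=
  (QuotientGroup.mk g : G i ⧸ (f i k).range).out

theorem exists_rem (i k : Fin 3) (g : G i) : ∃ e : E k, rep f i k g * f i k e = g := by
  have h : (QuotientGroup.mk (rep f i k g) : G i ⧸ (f i k).range) = QuotientGroup.mk g :=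
    Quotient.out_eq _
  obtain ⟨e, he⟩ := QuotientGroup.eq.1 h
  exact ⟨e, by rw [he]; group⟩

/-- The element of `E k` carrying `rep f i k g` to `g`. -/
noncomputable def rem (i k : Fin 3) (g : G i) : E k := (exists_rem f i k g).choose

theorem rep_mul_rem (i k : Fin 3) (g : G i) : rep f i k g * f i k (rem f i k g) = g :=
  (exists_rem f i k g).choose_spec

theorem rep_mul (i k : Fin 3) (g : G i) (e : E k) : rep f i k (g * f i k e) = rep f i k g := by
  unfold rep
  congr 1
  rw [QuotientGroup.eq]
  exact ⟨e⁻¹, by simp⟩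

theorem rep_rep (i k : Fin 3) (g : G i) : rep f i k (rep f i k g) = rep f i k g := by
  rw [← rep_mul f i k _ (rem f i k g), rep_mul_rem]

open Classical in
/-- The vertex of colour `j` of the chamber with coordinate `w.2` at `w.1`, when this vertex is
farther from the root than `w.1`; the parents of `w.1` are given by `pu`. -/
noncomputable def upAux {i : Fin 3} (pu : ∀ j, Option (TriVertex G E i₀ j × G j))
    (w : TriVertex G E i₀ i × G i) (j : Fin 3) : TriVertex G E i₀ j × G j :=
  if H : ∃ (q : TriVertex G E i₀ j × G j) (k : Fin 3) (a c : E k) (b : E j),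
      pu j = some q ∧ k ≠ i ∧ k ≠ j ∧ b ≠ 1 ∧ w.2 = f i k a * f i j b * f i k c then
    (two H.choose.1
        (H.choose.2 * f j H.choose_spec.choose H.choose_spec.choose_spec.choose)
        H.choose_spec.choose_spec.choose_spec.choose_spec.choose,
      f j H.choose_spec.choose H.choose_spec.choose_spec.choose_spec.choose)
  else (one j w.1 (rep f i (third i j) w.2), f j (third i j) (rem f i (third i j) w.2))

/-- The parents of a vertex, indexed by colour; the second component is the coordinate, at the
parent, of the base chamber of the vertex. -/
noncomputable def par : ∀ {i : Fin 3}, TriVertex G E i₀ i →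
    ∀ j, Option (TriVertex G E i₀ j × G j)
  | _, root, _ => none
  | _, @one _ _ _ i _ u r, l => if h : i = l then some (h ▸ (u, r)) else none
  | _, @two _ _ _ i u h e, l =>
      if i = l then none else
        some ((upAux f (par u) (u, h) l).1, (upAux f (par u) (u, h) l).2 * f l i e)

/-- The vertex of colour `j` of the chamber with coordinate `w.2` at `w.1`, when this vertex is
farther from the root than `w.1`, together with the coordinate of the chamber there. -/
noncomputable def up {i : Fin 3} (w : TriVertex G E i₀ i × G i) (j : Fin 3) :
    TriVertex G E i₀ j × G j :=
  upAux f (par f w.1) w j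

/-- The vertex has a parent of colour `j`. -/
def HasPar {i : Fin 3} (y : TriVertex G E i₀ i) (j : Fin 3) : Prop := ∃ q, par f y j = some q

/-- The vertex of colour `j` of the chamber with coordinate `g` at `y` is farther from the root
than `y`. -/
def Up {i : Fin 3} (y : TriVertex G E i₀ i) (g : G i) (j : Fin 3) : Prop :=
  ∀ k, k ≠ i → k ≠ j → (HasPar f y j → ∀ a : E k, g ≠ f i k a) ∧
    (HasPar f y k → ∀ (p : E j) (q : E k), g ≠ f i j p * f i k q)

/-- The vertex of colour `j` of the chamber with coordinate `g` at `y` is at distance two from the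
parents of `y` in the link of `y`. -/
def Dist2 {i : Fin 3} (y : TriVertex G E i₀ i) (g : G i) (j : Fin 3) : Prop :=
  HasPar f y j ∧ ∃ (k : Fin 3) (a c : E k) (b : E j), k ≠ i ∧ k ≠ j ∧ b ≠ 1 ∧
    g = f i k a * f i j b * f i k c

/-- The vertex `y` is the one closest to the root in the chamber with coordinate `g` at `y`. -/
def Far {i : Fin 3} (y : TriVertex G E i₀ i) (g : G i) : Prop := ∀ j, j ≠ i → Up f y g j

/-- The normal forms that actually occur. -/
def Valid : ∀ {i : Fin 3}, TriVertex G E i₀ i → Prop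
  | _, root => True
  | _, @one _ _ _ i j u r => Valid u ∧ i ≠ j ∧ Up f u r j ∧ ¬ Dist2 f u r j ∧
      rep f i (third i j) r = r
  | _, @two _ _ _ _ u h e => Valid u ∧ Far f u h ∧ e ≠ 1

/-- The distance to the root. -/
def lvl : ∀ {i : Fin 3}, TriVertex G E i₀ i → ℕ
  | _, root => 0
  | _, one _ u _ => lvl u + 1
  | _, two u _ _ => lvl u + 2

@[simp] theorem par_root (j : Fin 3) : par f (root : TriVertex G E i₀ i₀) j = none := by
  simp [par]

@[simp] theorem par_one_self {i : Fin 3} (j : Fin 3) (u : TriVertex G E i₀ i) (r : G i) :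
    par f (one j u r) i = some (u, r) := by simp [par]

theorem par_one_ne {i l : Fin 3} (j : Fin 3) (u : TriVertex G E i₀ i) (r : G i) (h : i ≠ l) :
    par f (one j u r) l = none := by simp [par, h]

@[simp] theorem par_two_self {i : Fin 3} (u : TriVertex G E i₀ i) (h : G i) (e : E i) :
    par f (two u h e) i = none := by simp [par]

theorem par_two_ne {i l : Fin 3} (u : TriVertex G E i₀ i) (h : G i) (e : E i) (hl : i ≠ l) :
    par f (two u h e) l = some ((up f (u, h) l).1, (up f (u, h) l).2 * f l i e) := by
  simp [par, hl, up]

variable {f}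

theorem _root_.TriHyp.disj (hf : TriHyp f) {i j k : Fin 3} (hij : i ≠ j) (hik : i ≠ k)
    (hjk : j ≠ k) {p : E j} {q : E k} (h : f i j p = f i k q) : p = 1 ∧ q = 1 := by
  have h1 := hf.link i j k hij hik hjk p 1 q⁻¹ 1 (by simp [h])
  rcases h1 with h1 | h1
  · subst h1
    exact ⟨rfl, hf.inj i k hik (by simpa using h.symm)⟩
  · have h2 : q = 1 := by simpa using h1
    subst h2
    exact ⟨hf.inj i j hij (by simpa using h), rfl⟩

theorem _root_.TriHyp.prod_inj (hf : TriHyp f) {i j k : Fin 3} (hij : i ≠ j) (hik : i ≠ k)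
    (hjk : j ≠ k) {p p' : E j} {q q' : E k} (h : f i j p * f i k q = f i j p' * f i k q') :
    p = p' ∧ q = q' := by
  have h1 : f i j (p'⁻¹ * p) = f i k (q' * q⁻¹) := by
    rw [map_mul, map_mul, map_inv, map_inv, inv_mul_eq_iff_eq_mul, ← mul_assoc,
      eq_mul_inv_iff_mul_eq, h]
  obtain ⟨h2, h3⟩ := hf.disj hij hik hjk h1
  exact ⟨(inv_mul_eq_one.1 h2).symm, (mul_inv_eq_one.1 h3).symm⟩

theorem _root_.TriHyp.triple_inj (hf : TriHyp f) {i j k : Fin 3} (hij : i ≠ j) (hik : i ≠ k)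
    (hjk : j ≠ k) {a a' c c' : E k} {b b' : E j} (hb : b ≠ 1)
    (h : f i k a * f i j b * f i k c = f i k a' * f i j b' * f i k c') :
    a = a' ∧ b = b' ∧ c = c' := by
  have h1 : f i k (a'⁻¹ * a) * f i j b = f i j b' * f i k (c' * c⁻¹) := by
    rw [map_mul, map_mul, map_inv, map_inv, mul_assoc, inv_mul_eq_iff_eq_mul, ← mul_assoc,
      ← mul_assoc, eq_mul_inv_iff_mul_eq, h]
  rcases hf.link i k j hik hij hjk.symm _ _ _ _ h1 with h2 | h2
  · have h3 : a = a' := (inv_mul_eq_one.1 h2).symm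
    subst h3
    rw [mul_assoc, mul_assoc, mul_right_inj] at h
    exact ⟨rfl, hf.prod_inj hij hik hjk h⟩
  · exact absurd h2 hb

theorem up_eq_two (hf : TriHyp f) {i j k : Fin 3} (hij : i ≠ j) (hik : i ≠ k) (hjk : j ≠ k)
    {y : TriVertex G E i₀ i} {q : TriVertex G E i₀ j} {h : G j} (hp : par f y j = some (q, h))
    (a c : E k) {b : E j} (hb : b ≠ 1) :
    up f (y, f i k a * f i j b * f i k c) j = (two q (h * f j k a) b, f j k c) := by
  have H : ∃ (q : TriVertex G E i₀ j × G j) (k' : Fin 3) (a' c' : E k') (b' : E j),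
      par f y j = some q ∧ k' ≠ i ∧ k' ≠ j ∧ b' ≠ 1 ∧
        (y, f i k a * f i j b * f i k c).2 = f i k' a' * f i j b' * f i k' c' :=
    ⟨(q, h), k, a, c, b, hp, hik.symm, hjk.symm, hb, rfl⟩
  have H' : up f (y, f i k a * f i j b * f i k c) j = (two H.choose.1
        (H.choose.2 * f j H.choose_spec.choose H.choose_spec.choose_spec.choose)
        H.choose_spec.choose_spec.choose_spec.choose_spec.choose,
      f j H.choose_spec.choose H.choose_spec.choose_spec.choose_spec.choose) := by
    unfold up upAux
    rw [dif_pos H]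
  rw [H']
  obtain ⟨h1, h2, h3, -, h5⟩ := H.choose_spec.choose_spec.choose_spec.choose_spec.choose_spec
  generalize H.choose_spec.choose_spec.choose_spec.choose_spec.choose = b' at *
  generalize H.choose_spec.choose_spec.choose_spec.choose = c' at *
  generalize H.choose_spec.choose_spec.choose = a' at *
  generalize H.choose_spec.choose = k' at *
  generalize H.choose = q' at *
  have hk : k' = k := by
    rw [← eq_third hij h2.symm h3.symm, eq_third hij hik hjk]
  subst hk
  obtain ⟨rfl, rfl, rfl⟩ := hf.triple_inj hij hik hjk hb h5
  rw [hp] at h1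
  cases h1
  rfl

theorem up_eq_one {i j k : Fin 3} (hij : i ≠ j) (hik : i ≠ k) (hjk : j ≠ k)
    {y : TriVertex G E i₀ i} {g : G i} (hd : ¬ Dist2 f y g j) :
    up f (y, g) j = (one j y (rep f i k g), f j k (rem f i k g)) := by
  have hk := eq_third hij hik hjk
  subst hk
  unfold up upAux
  rw [dif_neg]
  rintro ⟨q, k, a, c, b, h⟩
  exact hd ⟨⟨q, h.1⟩, k, a, c, b, h.2⟩

theorem Dist2.mul {i j k : Fin 3} (hij : i ≠ j) (hik : i ≠ k) (hjk : j ≠ k)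
    {y : TriVertex G E i₀ i} {g : G i} (e : E k) (hd : Dist2 f y g j) :
    Dist2 f y (g * f i k e) j := by
  obtain ⟨hq, k', a, c, b, h1, h2, h3, rfl⟩ := hd
  have hk : k' = k := by
    rw [← eq_third hij h1.symm h2.symm, eq_third hij hik hjk]
  subst hk
  exact ⟨hq, k', a, c * e, b, h1, h2, h3, by simp [mul_assoc]⟩

theorem dist2_mul_iff {i j k : Fin 3} (hij : i ≠ j) (hik : i ≠ k) (hjk : j ≠ k)
    {y : TriVertex G E i₀ i} {g : G i} (e : E k) :
    Dist2 f y (g * f i k e) j ↔ Dist2 f y g j := by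
  refine ⟨fun h => ?_, Dist2.mul hij hik hjk e⟩
  have := h.mul hij hik hjk e⁻¹
  simpa using this

theorem up_mul (hf : TriHyp f) {i j k : Fin 3} (hij : i ≠ j) (hik : i ≠ k) (hjk : j ≠ k)
    (y : TriVertex G E i₀ i) (g : G i) (e : E k) :
    up f (y, g * f i k e) j = ((up f (y, g) j).1, (up f (y, g) j).2 * f j k e) := by
  by_cases hd : Dist2 f y g j
  · obtain ⟨⟨⟨q, h⟩, hq⟩, k', a, c, b, h1, h2, h3, rfl⟩ := hd
    have hk : k' = k := by
      rw [← eq_third hij h1.symm h2.symm, eq_third hij hik hjk]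
    subst hk
    rw [mul_assoc _ (f i k' c), ← map_mul, up_eq_two hf hij hik hjk hq _ _ h3,
      up_eq_two hf hij hik hjk hq _ _ h3, map_mul]
  · rw [up_eq_one hij hik hjk hd,
      up_eq_one hij hik hjk (fun h => hd ((dist2_mul_iff hij hik hjk e).1 h)), rep_mul, ← map_mul]
    congr 2
    apply hf.inj i k hik
    rw [map_mul, ← mul_right_inj (rep f i k (g * f i k e)), rep_mul_rem, rep_mul, ← mul_assoc,
      rep_mul_rem]

theorem Up.mul {i j k : Fin 3} (hij : i ≠ j) (hik : i ≠ k) (hjk : j ≠ k)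
    {y : TriVertex G E i₀ i} {g : G i} (e : E k) (hu : Up f y g j) :
    Up f y (g * f i k e) j := by
  intro k' h1 h2
  have hk : k' = k := by
    rw [← eq_third hij h1.symm h2.symm, eq_third hij hik hjk]
  subst hk
  obtain ⟨h3, h4⟩ := hu k' h1 h2
  refine ⟨fun h a ha => h3 h (a * e⁻¹) ?_, fun h p q hq => h4 h p (q * e⁻¹) ?_⟩
  · rw [map_mul, ← ha]; simp
  · rw [map_mul, ← mul_assoc, ← hq]; simp

theorem up_iff {i j k : Fin 3} (hij : i ≠ j) (hik : i ≠ k) (hjk : j ≠ k)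
    {y : TriVertex G E i₀ i} {g : G i} : Up f y g j ↔
      (HasPar f y j → ∀ a : E k, g ≠ f i k a) ∧
      (HasPar f y k → ∀ (p : E j) (q : E k), g ≠ f i j p * f i k q) := by
  refine ⟨fun h => h k hik.symm hjk.symm, fun h k' h1 h2 => ?_⟩
  have hk : k' = k := by
    rw [← eq_third hij h1.symm h2.symm, eq_third hij hik hjk]
  subst hk
  exact h

theorem far_iff {i j k : Fin 3} (hij : i ≠ j) (hik : i ≠ k) (hjk : j ≠ k)
    {y : TriVertex G E i₀ i} {g : G i} : Far f y g ↔ Up f y g j ∧ Up f y g k := by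
  refine ⟨fun h => ⟨h j hij.symm, h k hik.symm⟩, fun h l hl => ?_⟩
  rcases eq_or_eq_or_eq hij hik hjk l with rfl | rfl | rfl
  · exact absurd rfl hl
  · exact h.1
  · exact h.2

theorem lvl_up_of {i : Fin 3} (y : TriVertex G E i₀ i)
    (hy : ∀ j q, par f y j = some q → lvl q.1 + 1 = lvl y) (g : G i) (j : Fin 3) :
    lvl (up f (y, g) j).1 = lvl y + 1 := by
  unfold up upAux
  split_ifs with H
  · have := hy j _ H.choose_spec.choose_spec.choose_spec.choose_spec.choose_spec.1
    simp only [lvl]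
    omega
  · simp [lvl]

theorem lvl_par {i : Fin 3} (y : TriVertex G E i₀ i) :
    ∀ j q, par f y j = some q → lvl q.1 + 1 = lvl y := by
  induction y with
  | root => simp
  | @one i j u r _ =>
    intro l q h
    by_cases hl : i = l
    · subst hl
      simp only [par_one_self, Option.some.injEq] at h
      subst h
      simp [lvl]
    · simp [par_one_ne f j u r hl] at h
  | @two i u h e ih =>
    intro l q hq
    by_cases hl : i = l
    · subst hl
      simp at hq
    · rw [par_two_ne f u h e hl, Option.some.injEq] at hq
      subst hq
      simp [lvl, lvl_up_of u ih]

theorem lvl_up {i : Fin 3} (y : TriVertex G E i₀ i) (g : G i) (j : Fin 3) :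
    lvl (up f (y, g) j).1 = lvl y + 1 := lvl_up_of y (lvl_par y) g j

end TriVertex

namespace TriVertex

variable {G E : Fin 3 → Type u} [∀ i, Group (G i)] [∀ i, Group (E i)] {i₀ : Fin 3}
  {f : ∀ i k, E k →* G i}

variable (f) in
/-- Going down from `y` to a parent and up again leads back to `y`. -/
def Good {i : Fin 3} (y : TriVertex G E i₀ i) : Prop :=
  ∀ j k, i ≠ j → i ≠ k → j ≠ k → ∀ q h, par f y j = some (q, h) →
    Valid f q ∧ Up f q h i ∧ up f (q, h) i = (y, 1) ∧
      ∀ a : E k, (HasPar f y k → a ≠ 1) → Far f q (h * f j k a)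

theorem Up.rep {i j k : Fin 3} (hij : i ≠ j) (hik : i ≠ k) (hjk : j ≠ k)
    {y : TriVertex G E i₀ i} {g : G i} (hu : Up f y g j) : Up f y (rep f i k g) j := by
  have h := hu.mul hij hik hjk (rem f i k g)⁻¹
  rwa [map_inv, ← eq_mul_inv_of_mul_eq (rep_mul_rem f i k g)] at h

theorem Good.up_of_far (hf : TriHyp f) {i j k : Fin 3} (hij : i ≠ j) (hik : i ≠ k) (hjk : j ≠ k)
    {u : TriVertex G E i₀ i} (hg : Good f u) (hv : Valid f u) {h₀ : G i} (hfar : Far f u h₀) :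
    ∃ (q : TriVertex G E i₀ j) (x : E k) (h₁ : G i), up f (u, h₀) j = (q, f j k x) ∧
      par f q i = some (u, h₁) ∧ h₀ = h₁ * f i k x ∧ (HasPar f q k → x ≠ 1) ∧ Valid f q := by
  by_cases hd : Dist2 f u h₀ j
  · obtain ⟨⟨⟨q', h'⟩, hq⟩, k', a, c, b, h1, h2, hb, rfl⟩ := hd
    have hk : k' = k := by
      rw [← eq_third hij h1.symm h2.symm, eq_third hij hik hjk]
    subst hk
    obtain ⟨hq1, hq2, hq3, hq4⟩ := hg j k' hij hik hjk q' h' hq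
    refine ⟨_, c, f i k' a * f i j b, up_eq_two hf hij hik hjk hq a c hb, ?_, rfl, ?_, hq1, ?_, hb⟩
    · rw [par_two_ne f _ _ _ hij.symm, up_mul hf hij.symm hjk hik, hq3]
      simp
    · rintro - rfl
      exact ((up_iff hik hij hjk.symm).1 (hfar k' hik.symm)).2 ⟨_, hq⟩ a b (by simp)
    · refine hq4 a ?_
      rintro hP rfl
      exact ((up_iff hij hik hjk).1 (hfar j hij.symm)).2 hP b c (by simp)
  · refine ⟨_, rem f i k h₀, rep f i k h₀, up_eq_one hij hik hjk hd, par_one_self _ _ _ _,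
      (rep_mul_rem _ _ _ _).symm, ?_, hv, hij, (hfar j hij.symm).rep hij hik hjk, ?_, ?_⟩
    · rintro ⟨q, hq⟩
      simp [par_one_ne f j u _ hik] at hq
    · intro h
      have := h.mul hij hik hjk (rem f i k h₀)
      rw [rep_mul_rem] at this
      exact hd this
    · rw [eq_third hij hik hjk, rep_rep]

theorem good (hf : TriHyp f) {i : Fin 3} (y : TriVertex G E i₀ i) (hy : Valid f y) :
    Good f y := by
  induction y with
  | root =>
    intro j k _ _ _ q h hq
    simp at hq
  | @one j i u r _ =>
    intro j' k hij hik hjk q h hq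
    by_cases hj : j = j'
    swap
    · simp [par_one_ne f i u r hj] at hq
    subst hj
    rw [par_one_self] at hq
    obtain ⟨rfl, rfl⟩ : u = q ∧ r = h := by simpa using hq
    obtain ⟨hv, -, hup, hd, hr⟩ := hy
    rw [eq_third hij.symm hjk hik] at hr
    refine ⟨hv, hup, ?_, ?_⟩
    · rw [up_eq_one hij.symm hjk hik hd, hr]
      have h1 : rem f j k r = 1 := by
        apply hf.inj j k hjk
        have := rep_mul_rem f j k r
        rw [hr] at this
        simpa using this
      simp [h1]
    · intro a _
      rw [far_iff hij.symm hjk hik]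
      refine ⟨hup.mul hij.symm hjk hik a, ?_⟩
      rw [up_iff hjk hij.symm hik.symm]
      rw [up_iff hij.symm hjk hik] at hup
      refine ⟨fun hP b hb => ?_, fun hP x b hb => ?_⟩
      · refine hup.2 hP b a⁻¹ ?_
        rw [← hb]; simp
      · by_cases hb1 : b = 1
        · subst hb1
          refine hup.1 hP (x * a⁻¹) ?_
          rw [map_mul, ← mul_one (f j k x), ← map_one (f j i), ← hb]; simp
        · refine hd ⟨hP, k, x, a⁻¹, b, hjk.symm, hik.symm, hb1, ?_⟩
          rw [← hb]; simp
  | @two i u h₀ e ih =>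
    intro j k hij hik hjk q h hq
    obtain ⟨hv, hfar, he⟩ := hy
    obtain ⟨q', x, h₁, hq1, hq2, rfl, hx, hq3⟩ := (ih hv).up_of_far hf hij hik hjk hv hfar
    rw [par_two_ne f u _ e hij, hq1] at hq
    obtain ⟨rfl, rfl⟩ : q' = q ∧ f j k x * f j i e = h := by simpa using hq
    have hk : HasPar f (two u (h₁ * f i k x) e) k := ⟨_, par_two_ne f u _ e hik⟩
    refine ⟨hq3, ?_, ?_, ?_⟩
    · rw [up_iff hij.symm hjk hik]
      refine ⟨fun _ a ha => ?_, fun hP b c hb => ?_⟩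
      · apply he
        refine (hf.disj hij.symm hjk hik (p := e) (q := x⁻¹ * a) ?_).1
        rw [map_mul, ← ha]; simp
      · rcases hf.link j k i hjk hij.symm hik.symm _ _ _ _ hb with h | h
        · exact hx hP h
        · exact he h
    · have := up_eq_two hf hij.symm hjk hik hq2 x 1 he
      simpa using this
    · intro a ha
      have ha := ha hk
      rw [far_iff hjk hij.symm hik.symm]
      refine ⟨?_, ?_⟩
      · rw [up_iff hjk hij.symm hik.symm]
        refine ⟨fun hP b hb => ?_, fun _ a' b hb => ?_⟩
        · have := hf.link j k i hjk hij.symm hik.symm x a⁻¹ e b (by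
            rw [map_inv, ← hb]; simp)
          exact this.elim (hx hP) he
        · have := hf.link j i k hij.symm hjk hik e b a (x⁻¹ * a') (by
            rw [map_mul, map_inv, mul_assoc, ← hb]; group)
          exact this.elim he ha
      · rw [up_iff hij.symm hjk hik]
        refine ⟨fun _ b hb => ?_, fun hP b c hb => ?_⟩
        · refine he (hf.disj hij.symm hjk hik (p := e) (q := x⁻¹ * b * a⁻¹) ?_).1
          rw [map_mul, map_mul, ← hb]; simp [mul_assoc]
        · have := hf.link j k i hjk hij.symm hik.symm x (c * a⁻¹) e b (by
            rw [map_mul, ← mul_assoc, ← hb]; simp)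
          exact this.elim (hx hP) he

end TriVertex

namespace TriVertex

variable {G E : Fin 3 → Type u} [∀ i, Group (G i)] [∀ i, Group (E i)] {i₀ : Fin 3}
  {f : ∀ i k, E k →* G i}

open Classical in
/-- The flag, at the vertices of the colour of `u`, of the chamber obtained from the one with
coordinate `g` at `u` by crossing with `e` its edge opposite to `u`. -/
noncomputable def top {i : Fin 3} (u : TriVertex G E i₀ i) (g : G i) (e : E i) :
    TriVertex G E i₀ i × G i :=
  if e = 1 then (u, g) else (two u g e, 1)

variable (f) in
/-- The chambers of the development, as triples of flags. -/
def IsChamber (v : ∀ j, TriVertex G E i₀ j × G j) : Prop :=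
  ∃ (i : Fin 3) (u : TriVertex G E i₀ i) (g : G i) (e : E i), Valid f u ∧ Far f u g ∧
    v i = top u g e ∧
      ∀ j, j ≠ i → v j = ((up f (u, g) j).1, (up f (u, g) j).2 * f j i e)

theorem top_one {i : Fin 3} (u : TriVertex G E i₀ i) (g : G i) : top u g (1 : E i) = (u, g) := by
  simp [top]

theorem top_ne {i : Fin 3} (u : TriVertex G E i₀ i) (g : G i) {e : E i} (he : e ≠ 1) :
    top u g e = (two u g e, 1) := by
  simp [top, he]

theorem exists_isChamber {i : Fin 3} {u : TriVertex G E i₀ i} {g : G i} (hu : Valid f u)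
    (hg : Far f u g) (e : E i) : ∃ v, IsChamber f v ∧ v i = top u g e ∧
      ∀ j, j ≠ i → v j = ((up f (u, g) j).1, (up f (u, g) j).2 * f j i e) := by
  refine ⟨fun j => if h : i = j then h ▸ top u g e else
    ((up f (u, g) j).1, (up f (u, g) j).2 * f j i e), ⟨i, u, g, e, hu, hg, ?_⟩, ?_⟩
  · refine ⟨by simp, fun j hj => by simp [hj.symm]⟩
  · refine ⟨by simp, fun j hj => by simp [hj.symm]⟩

/-- The description of a chamber at a vertex which is not of the special colour. -/
theorem flag_of_ne (hf : TriHyp f) {i j k : Fin 3} (hij : i ≠ j) (hik : i ≠ k) (hjk : j ≠ k)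
    {u : TriVertex G E i₀ k} {g : G k} (hu : Valid f u) (hg : Far f u g) (e : E k) :
    ∃ (q : TriVertex G E i₀ i) (x : E j) (h : G k),
      ((up f (u, g) i).1, (up f (u, g) i).2 * f i k e) = (q, f i j x * f i k e) ∧
      par f q k = some (u, h) ∧ g = h * f k j x ∧ (HasPar f q j → x ≠ 1) ∧ Valid f q ∧
      lvl q = lvl u + 1 := by
  obtain ⟨q, x, h, h1, h2, h3, h4, h5⟩ :=
    (good hf u hu).up_of_far hf hik.symm hjk.symm hij hu hg
  refine ⟨q, x, h, by rw [h1], h2, h3, h4, h5, ?_⟩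
  rw [← lvl_up (f := f) u g i, h1]

theorem IsChamber.valid (hf : TriHyp f) {v : ∀ j, TriVertex G E i₀ j × G j}
    (hv : IsChamber f v) (i : Fin 3) : Valid f (v i).1 := by
  obtain ⟨k, u, g, e, hu, hg, h1, h2⟩ := hv
  by_cases hik : i = k
  · subst hik
    rw [h1]
    by_cases he : e = 1
    · subst he
      rwa [top_one]
    · rw [top_ne _ _ he]
      exact ⟨hu, hg, he⟩
  · obtain ⟨hij, hkj⟩ := third_ne hik
    obtain ⟨q, x, h, h3, -, -, -, h4, -⟩ := flag_of_ne hf hij hik hkj.symm hu hg e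
    rw [h2 i hik, h3]
    exact h4

theorem exists_par_two {i j : Fin 3} (hij : i ≠ j) (u : TriVertex G E i₀ i) (h : G i) (e : E i) :
    HasPar f (two u h e) j := ⟨_, par_two_ne f u h e hij⟩

theorem IsChamber.ext (hf : TriHyp f) {v v' : ∀ j, TriVertex G E i₀ j × G j}
    (hv : IsChamber f v) (hv' : IsChamber f v') {i : Fin 3} (h : v i = v' i) : v = v' := by
  have key : ∀ {k} (u : TriVertex G E i₀ k) (g : G k) (e : E k)
      {v v' : ∀ j, TriVertex G E i₀ j × G j},
      v k = top u g e →
      (∀ j, j ≠ k → v j = ((up f (u, g) j).1, (up f (u, g) j).2 * f j k e)) →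
      v' k = top u g e →
      (∀ j, j ≠ k → v' j = ((up f (u, g) j).1, (up f (u, g) j).2 * f j k e)) → v = v' := by
    intro k u g e v v' h1 h2 h3 h4
    funext j
    by_cases hj : j = k
    · subst hj
      rw [h1, h3]
    · rw [h2 j hj, h4 j hj]
  have mixed : ∀ {i k} (_ : i ≠ k) {u : TriVertex G E i₀ i} {g : G i} {e : E i}
      {u' : TriVertex G E i₀ k} {g' : G k} {e' : E k}, Valid f u → Far f u g → Valid f u' →
      Far f u' g' → top u g e ≠ ((up f (u', g') i).1, (up f (u', g') i).2 * f i k e') := by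
    intro i k hik u g e u' g' e' hu hg hu' hg' heq
    obtain ⟨hij, hkj⟩ := third_ne hik
    obtain ⟨q, x, h, h3, h4, h5, h6, h7, -⟩ := flag_of_ne hf hij hik hkj.symm hu' hg' e'
    rw [h3] at heq
    by_cases he : e = 1
    · subst he
      rw [top_one] at heq
      obtain ⟨rfl, rfl⟩ : u = q ∧ g = _ := by simpa using heq
      exact ((up_iff hij hik hkj.symm).1 (hg _ hij.symm)).2 ⟨_, h4⟩ _ _ rfl
    · rw [top_ne _ _ he] at heq
      simp only [Prod.mk.injEq] at heq
      obtain ⟨rfl, h8⟩ := heq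
      refine h6 (exists_par_two hij _ _ _) ?_
      refine (hf.disj hij hik hkj.symm (p := x) (q := e'⁻¹) ?_).1
      rw [map_inv]
      exact eq_inv_of_mul_eq_one_left h8.symm
  obtain ⟨k, u, g, e, hu, hg, h1, h2⟩ := hv
  obtain ⟨k', u', g', e', hu', hg', h1', h2'⟩ := hv'
  by_cases hik : i = k
  · subst hik
    by_cases hik' : i = k'
    · subst hik'
      rw [h1, h1'] at h
      have : u = u' ∧ g = g' ∧ e = e' := by
        by_cases he : e = 1
        · by_cases he' : e' = 1
          · subst he he'
            simpa [top_one] using h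
          · subst he
            rw [top_one, top_ne _ _ he'] at h
            obtain ⟨rfl, rfl⟩ : u = _ ∧ g = 1 := by simpa using h
            obtain ⟨j, hij⟩ := exists_ne i
            have h4 := third_ne hij.symm
            exact absurd (map_one (f i (third i j))).symm
              (((up_iff hij.symm h4.1 h4.2).1 (hg j hij)).1 (exists_par_two hij.symm _ _ _) 1)
        · by_cases he' : e' = 1
          · subst he'
            rw [top_one, top_ne _ _ he] at h
            obtain ⟨rfl, rfl⟩ : _ = u' ∧ 1 = g' := by simpa using h
            obtain ⟨j, hij⟩ := exists_ne i
            have h4 := third_ne hij.symm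
            exact absurd (map_one (f i (third i j))).symm
              (((up_iff hij.symm h4.1 h4.2).1 (hg' j hij)).1 (exists_par_two hij.symm _ _ _) 1)
          · rw [top_ne _ _ he, top_ne _ _ he'] at h
            simpa using h
      obtain ⟨rfl, rfl, rfl⟩ := this
      exact key u g e h1 h2 h1' h2'
    · rw [h1, h2' i hik'] at h
      exact absurd h (mixed hik' hu hg hu' hg')
  · by_cases hik' : i = k'
    · subst hik'
      rw [h1', h2 i hik] at h
      exact absurd h.symm (mixed hik hu' hg' hu hg)
    · rw [h2 i hik, h2' i hik'] at h
      by_cases hk : k = k'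
      · subst hk
        obtain ⟨hij, hkj⟩ := third_ne hik
        obtain ⟨q, x, c, h3, h4, h5, -⟩ := flag_of_ne hf hij hik hkj.symm hu hg e
        obtain ⟨q', x', c', h3', h4', h5', -⟩ := flag_of_ne hf hij hik hkj.symm hu' hg' e'
        rw [h3, h3'] at h
        simp only [Prod.mk.injEq] at h
        obtain ⟨rfl, h6⟩ := h
        obtain ⟨rfl, rfl⟩ := hf.prod_inj hij hik hkj.symm h6
        rw [h4] at h4'
        simp only [Option.some.injEq, Prod.mk.injEq] at h4'
        obtain ⟨rfl, rfl⟩ := h4'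
        obtain rfl := h5.trans h5'.symm
        exact key u g e h1 h2 h1' h2'
      · exfalso
        obtain ⟨q, x, c, h3, h4, h5, h6, -⟩ := flag_of_ne hf hik' hik (Ne.symm hk) hu hg e
        obtain ⟨q', x', c', h3', h4', h5', h6', -⟩ := flag_of_ne hf hik hik' hk hu' hg' e'
        rw [h3, h3'] at h
        simp only [Prod.mk.injEq] at h
        obtain ⟨rfl, h7⟩ := h
        rcases hf.link i k' k hik' hik (Ne.symm hk) _ _ _ _ h7 with h8 | h8
        · exact h6 ⟨_, h4'⟩ h8
        · subst h8
          refine h6' ⟨_, h4⟩ (hf.disj hik' hik (Ne.symm hk) (p := x * e'⁻¹) (q := x') ?_).2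
          rw [map_mul, map_inv, mul_inv_eq_iff_eq_mul, ← h7]
          simp

theorem IsChamber.rotate_aux (hf : TriHyp f) {v : ∀ j, TriVertex G E i₀ j × G j} {i j k : Fin 3}
    (hij : i ≠ j) (hik : i ≠ k) (hjk : j ≠ k) {u : TriVertex G E i₀ i} {g : G i} {e₀ : E i}
    (hu : Valid f u) (hg : Far f u g) (h1 : v i = top u g e₀)
    (h2 : ∀ j, j ≠ i → v j = ((up f (u, g) j).1, (up f (u, g) j).2 * f j i e₀)) {e : E k}
    (he : e ≠ 1) : ∃ v', IsChamber f v' ∧ v' i = ((v i).1, (v i).2 * f i k e) ∧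
      v' j = ((v j).1, (v j).2 * f j k e) := by
  by_cases he₀ : e₀ = 1
  · subst he₀
    have h2j : ((v j).1, (v j).2 * f j k e) = up f (u, g * f i k e) j := by
      rw [h2 j hij.symm, up_mul hf hij hik hjk]; simp
    rw [h2j, h1, top_one]
    have hj := hg j hij.symm
    have hj' := (up_iff hij hik hjk).1 hj
    by_cases hk : Up f u (g * f i k e) k
    · obtain ⟨v', h3, h4, h5⟩ := exists_isChamber hu
        ((far_iff hij hik hjk).2 ⟨hj.mul hij hik hjk e, hk⟩) 1
      refine ⟨v', h3, by rw [h4, top_one], by rw [h5 j hij.symm]; simp⟩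
    · have : HasPar f u j ∧ ∃ (p : E k) (b : E j), g * f i k e = f i k p * f i j b := by
        by_contra hcon
        refine hk ((up_iff hik hij hjk.symm).2 ⟨fun hP a ha => ?_, fun hP p b hpb => ?_⟩)
        · refine hj'.2 hP a e⁻¹ ?_
          rw [← ha]; simp
        · exact hcon ⟨hP, p, b, hpb⟩
      obtain ⟨⟨⟨q, h⟩, hq⟩, p, b, hpb⟩ := this
      have hb : b ≠ 1 := by
        rintro rfl
        refine hj'.1 ⟨_, hq⟩ (p * e⁻¹) ?_
        rw [map_mul, map_inv, eq_mul_inv_iff_mul_eq, hpb]; simp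
      obtain ⟨hq1, hq2, hq3, hq4⟩ := good hf u hu j k hij hik hjk q h hq
      have hfar := hq4 p (by
        rintro hP rfl
        refine hj'.2 hP b e⁻¹ ?_
        rw [map_inv, eq_mul_inv_iff_mul_eq, hpb]; simp)
      obtain ⟨v', h3, h4, h5⟩ := exists_isChamber hq1 hfar b
      refine ⟨v', h3, ?_, ?_⟩
      · rw [h5 i hij, up_mul hf hij.symm hjk hik, hq3, hpb]; simp
      · have := up_eq_two hf hij hik hjk hq p 1 hb
        rw [h4, top_ne _ _ hb, hpb]
        simpa using this.symm
  · obtain ⟨q, x, h, h3, h4, h5, h6, h7, -⟩ := flag_of_ne hf hjk.symm.symm hij.symm hik.symm hu hg e₀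
    have hP : par f (two u g e₀) j = some (q, f j k x * f j i e₀) := by
      rw [par_two_ne f u g e₀ hij, h3]
    have hv : Valid f (two u g e₀) := ⟨hu, hg, he₀⟩
    obtain ⟨-, -, -, hfar⟩ := good hf _ hv j k hij hik hjk _ _ hP
    obtain ⟨v', h8, h9, h10⟩ := exists_isChamber h7 (hfar e fun _ => he) 1
    refine ⟨v', h8, ?_, ?_⟩
    · rw [h10 i hij, h1, top_ne _ _ he₀, up_eq_two hf hij.symm hjk hik h4 x e he₀, ← h5]
      simp
    · rw [h9, top_one, h2 j hij.symm, h3]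

theorem IsChamber.rotate (hf : TriHyp f) {v : ∀ j, TriVertex G E i₀ j × G j}
    (hv : IsChamber f v) {i j k : Fin 3} (hij : i ≠ j) (hik : i ≠ k) (hjk : j ≠ k) (e : E k) :
    ∃ v', IsChamber f v' ∧ v' i = ((v i).1, (v i).2 * f i k e) ∧
      v' j = ((v j).1, (v j).2 * f j k e) := by
  by_cases he : e = 1
  · subst he
    exact ⟨v, hv, by simp, by simp⟩
  obtain ⟨l, u, g, e₀, hu, hg, h1, h2⟩ := hv
  rcases eq_or_eq_or_eq hij hik hjk l with rfl | rfl | rfl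
  · exact IsChamber.rotate_aux hf hij hik hjk hu hg h1 h2 he
  · obtain ⟨v', h3, h4, h5⟩ := IsChamber.rotate_aux hf hij.symm hjk hik hu hg h1 h2 he
    exact ⟨v', h3, h5, h4⟩
  · obtain ⟨v', h3, h4, h5⟩ := exists_isChamber hu hg (e₀ * e)
    refine ⟨v', h3, ?_, ?_⟩
    · rw [h5 i hik, h2 i hik]; simp [mul_assoc]
    · rw [h5 j hjk, h2 j hjk]; simp [mul_assoc]

theorem exists_isChamber_base (hf : TriHyp f) {i : Fin 3} {y : TriVertex G E i₀ i}
    (hy : Valid f y) : ∃ v, IsChamber f v ∧ v i = (y, 1) ∧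
      ∀ j q, par f y j = some q → v j = q := by
  have hgood := good hf y hy
  cases y with
  | root =>
    have hfar : Far f (root : TriVertex G E i₀ i₀) 1 := by
      intro j _ k _ _
      refine ⟨fun h => ?_, fun h => ?_⟩ <;>
      · obtain ⟨q, hq⟩ := h
        simp at hq
    obtain ⟨v, h1, h2, h3⟩ := exists_isChamber hy hfar 1
    exact ⟨v, h1, by rw [h2, top_one], by simp⟩
  | @one j _ u r =>
    have hij := hy.2.1
    obtain ⟨hik, hjk⟩ := third_ne hij
    obtain ⟨hq1, hq2, hq3, hq4⟩ := hgood j _ hij.symm hjk hik u r (par_one_self f _ _ _)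
    have hfar := hq4 1 (by
      rintro ⟨q, hq⟩
      simp [par_one_ne f i u r hik] at hq)
    rw [map_one, mul_one] at hfar
    obtain ⟨v, h1, h2, h3⟩ := exists_isChamber hq1 hfar 1
    refine ⟨v, h1, by rw [h3 i hij.symm, hq3]; simp, fun l q hq => ?_⟩
    by_cases hl : j = l
    · subst hl
      rw [par_one_self] at hq
      rw [h2, top_one]
      simpa using hq
    · simp [par_one_ne f i u r hl] at hq
  | two u h e =>
    obtain ⟨hu, hfar, he⟩ := hy
    obtain ⟨v, h1, h2, h3⟩ := exists_isChamber hu hfar e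
    refine ⟨v, h1, by rw [h2, top_ne _ _ he], fun l q hq => ?_⟩
    by_cases hl : i = l
    · subst hl
      simp at hq
    · rw [par_two_ne f u h e hl, Option.some.injEq] at hq
      rw [← hq, h3 l (Ne.symm hl)]

theorem exists_isChamber_flag (hf : TriHyp f)
    (hgen : ∀ i j k, i ≠ j → i ≠ k → j ≠ k → (f i j).range ⊔ (f i k).range = ⊤)
    {i : Fin 3} {y : TriVertex G E i₀ i}
    (hy : Valid f y) (g : G i) : ∃ v, IsChamber f v ∧ v i = (y, g) := by
  let K : Subgroup (G i) :=
    { carrier := {z | ∀ g, (∃ v, IsChamber f v ∧ v i = (y, g * z)) ↔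
        (∃ v, IsChamber f v ∧ v i = (y, g))}
      one_mem' := by simp
      mul_mem' := by
        intro a b ha hb g
        rw [← mul_assoc, hb, ha]
      inv_mem' := by
        intro a ha g
        rw [← ha]; simp }
  have hK : ∀ j, i ≠ j → (f i j).range ≤ K := by
    rintro j hij _ ⟨e, rfl⟩
    obtain ⟨hik, hjk⟩ := third_ne hij
    have : ∀ (e : E j) g, (∃ v, IsChamber f v ∧ v i = (y, g)) →
        (∃ v, IsChamber f v ∧ v i = (y, g * f i j e)) := by
      rintro e g ⟨v, hv, hvi⟩
      obtain ⟨v', h1, h2, -⟩ := hv.rotate hf hik hij hjk.symm e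
      exact ⟨v', h1, by rw [h2, hvi]⟩
    intro g
    refine ⟨fun h => ?_, this e g⟩
    have := this e⁻¹ _ h
    simpa using this
  obtain ⟨j, hij⟩ := exists_ne i
  obtain ⟨hik, hjk⟩ := third_ne hij.symm
  have hg : g ∈ K := by
    have h1 := sup_le (hK j hij.symm) (hK _ hik)
    rw [hgen _ _ _ hij.symm hik hjk] at h1
    exact h1 trivial
  obtain ⟨v, h1, h2, -⟩ := exists_isChamber_base hf hy
  have := (hg 1).2 ⟨v, h1, h2⟩
  simpa using this

theorem IsChamber.lvl_le {v : ∀ j, TriVertex G E i₀ j × G j}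
    (hv : IsChamber f v) (i j : Fin 3) : lvl (v i).1 ≤ lvl (v j).1 + 1 := by
  obtain ⟨l, u, g, e, hu, hg, h1, h2⟩ := hv
  have h3 : lvl (v l).1 = lvl u ∨ lvl (v l).1 = lvl u + 2 := by
    rw [h1]
    by_cases he : e = 1
    · subst he; simp [top_one]
    · simp [top_ne _ _ he, lvl]
  have h4 : ∀ j, j ≠ l → lvl (v j).1 = lvl u + 1 := by
    intro j hj
    rw [h2 j hj]
    simp [lvl_up]
  by_cases hi : i = l
  · by_cases hj : j = l
    · rw [hi, hj]; omega
    · have := h4 j hj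
      rw [hi]; omega
  · have := h4 i hi
    by_cases hj : j = l
    · rw [hj]; omega
    · have := h4 j hj; omega

theorem IsChamber.mem_range (hf : TriHyp f) {v : ∀ j, TriVertex G E i₀ j × G j}
    (hv : IsChamber f v) {i j k : Fin 3} (hij : i ≠ j) (hik : i ≠ k) (hjk : j ≠ k)
    (h : lvl (v j).1 < lvl (v i).1) : ∃ x : E k, (v i).2 = f i k x := by
  obtain ⟨l, u, g, e, hu, hg, h1, h2⟩ := hv
  have h4 : ∀ j, j ≠ l → lvl (v j).1 = lvl u + 1 := by
    intro j hj
    rw [h2 j hj]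
    simp [lvl_up]
  rcases eq_or_eq_or_eq hij hik hjk l with rfl | rfl | rfl
  · by_cases he : e = 1
    · subst he
      have := h4 j hij.symm
      rw [h1, top_one, this] at h
      simp at h
    · rw [h1, top_ne _ _ he]
      exact ⟨1, by simp⟩
  · by_cases he : e = 1
    · subst he
      obtain ⟨q, x, h, h3, -⟩ := flag_of_ne hf hik hij hjk.symm hu hg 1
      rw [h2 i hij, h3]
      exact ⟨x, by simp⟩
    · rw [h4 i hij, h1, top_ne _ _ he] at h
      simp [lvl] at h
  · rw [h4 i hik, h4 j hjk] at h
    exact absurd h (lt_irrefl _)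

theorem eq_of_lvl_eq_zero {i : Fin 3} (y : TriVertex G E i₀ i) (hy : lvl y = 0) :
    ∃ h : i₀ = i, y = h ▸ root := by
  cases y with
  | root => exact ⟨rfl, rfl⟩
  | one j u r => simp [lvl] at hy
  | two u h e => simp [lvl] at hy

theorem ne_of_lvl_eq_one {i : Fin 3} (y : TriVertex G E i₀ i) (hv : Valid f y) (hy : lvl y = 1) :
    i ≠ i₀ := by
  cases y with
  | root => simp [lvl] at hy
  | one j u r =>
    obtain ⟨rfl, -⟩ := eq_of_lvl_eq_zero u (by simpa [lvl] using hy)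
    exact hv.2.1.symm
  | two u h e => simp [lvl] at hy

theorem hasPar_of_lvl_pos {i : Fin 3} (y : TriVertex G E i₀ i) (hv : Valid f y) (hy : 0 < lvl y) :
    ∃ j q, i ≠ j ∧ par f y j = some q := by
  cases y with
  | root => simp [lvl] at hy
  | @one l j u r => exact ⟨l, _, hv.2.1.symm, par_one_self _ _ _ _⟩
  | two u h e =>
    obtain ⟨j, hij⟩ := exists_ne i
    exact ⟨j, _, hij.symm, par_two_ne f u h e hij.symm⟩

end TriVertex

/-- The group `A` is the colimit of a triangle of groups with maps `φ i` from the vertex groups,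
and the edge groups generate the vertex groups. -/
structure TriAmalgam {G E : Fin 3 → Type u} [∀ i, Group (G i)] [∀ i, Group (E i)]
    (f : ∀ i k, E k →* G i) {A : Type u} [Group A] (φ : ∀ i, G i →* A) : Prop where
  compat : ∀ i j k, i ≠ k → j ≠ k → ∀ e : E k, φ i (f i k e) = φ j (f j k e)
  gen_vertex : ∀ i j k, i ≠ j → i ≠ k → j ≠ k → (f i j).range ⊔ (f i k).range = ⊤
  gen : ⨆ i, (φ i).range = ⊤
  lift : ∀ (H : Type u) [Group H] (ψ : ∀ i, G i →* H),
    (∀ i j k, i ≠ k → j ≠ k → ∀ e : E k, ψ i (f i k e) = ψ j (f j k e)) →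
    ∃ Ψ : A →* H, ∀ i g, Ψ (φ i g) = ψ i g

namespace TriVertex

variable {G E : Fin 3 → Type u} [∀ i, Group (G i)] [∀ i, Group (E i)] {i₀ : Fin 3}
  {f : ∀ i k, E k →* G i} {A : Type u} [Group A] {φ : ∀ i, G i →* A}

variable (f φ) in
/-- The element of `A` carrying the base chamber to the base chamber of a vertex. -/
def ev : ∀ {i : Fin 3}, TriVertex G E i₀ i → A
  | _, root => 1
  | _, @one _ _ _ i _ u r => ev u * φ i r
  | _, @two _ _ _ i u h e => ev u * φ i h * φ (i + 1) (f (i + 1) i e)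

theorem ev_two (hA : TriAmalgam f φ) {i j : Fin 3} (hij : i ≠ j) (u : TriVertex G E i₀ i)
    (h : G i) (e : E i) : ev f φ (two u h e) = ev f φ u * φ i h * φ j (f j i e) := by
  simp only [ev]
  rw [hA.compat (i + 1) j i (by clear hij u h e; revert i; decide) hij.symm]

theorem ev_up_of (hf : TriHyp f) (hA : TriAmalgam f φ) {i : Fin 3} (y : TriVertex G E i₀ i)
    (hy : ∀ j q, par f y j = some q → ev f φ q.1 * φ j q.2 = ev f φ y) (g : G i) {j : Fin 3}
    (hij : i ≠ j) : ev f φ (up f (y, g) j).1 * φ j (up f (y, g) j).2 = ev f φ y * φ i g := by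
  obtain ⟨hik, hjk⟩ := third_ne hij
  by_cases hd : Dist2 f y g j
  · obtain ⟨⟨⟨q, h⟩, hq⟩, k', a, c, b, h1, h2, hb, rfl⟩ := hd
    rw [up_eq_two hf hij h1.symm h2.symm hq a c hb, ev_two hA hij.symm, ← hy j _ hq]
    simp only [map_mul, mul_assoc]
    rw [hA.compat i j k' h1.symm h2.symm a, hA.compat i j k' h1.symm h2.symm c]
  · rw [up_eq_one hij hik hjk hd]
    simp only [ev]
    rw [← hA.compat i j _ hik hjk, mul_assoc, ← map_mul, rep_mul_rem]

theorem ev_par (hf : TriHyp f) (hA : TriAmalgam f φ) {i : Fin 3} (y : TriVertex G E i₀ i) :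
    ∀ j q, par f y j = some q → ev f φ q.1 * φ j q.2 = ev f φ y := by
  induction y with
  | root => simp
  | @one i j u r _ =>
    intro l q h
    by_cases hl : i = l
    · subst hl
      simp only [par_one_self, Option.some.injEq] at h
      subst h
      simp [ev]
    · simp [par_one_ne f j u r hl] at h
  | @two i u h e ih =>
    intro l q hq
    by_cases hl : i = l
    · subst hl
      simp at hq
    · rw [par_two_ne f u h e hl, Option.some.injEq] at hq
      subst hq
      simp only [map_mul]
      rw [← mul_assoc, ev_up_of hf hA u ih h hl, ev_two hA hl]

theorem IsChamber.ev_eq (hf : TriHyp f) (hA : TriAmalgam f φ)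
    {v : ∀ j, TriVertex G E i₀ j × G j} (hv : IsChamber f v) (i j : Fin 3) :
    ev f φ (v i).1 * φ i (v i).2 = ev f φ (v j).1 * φ j (v j).2 := by
  obtain ⟨l, u, g, e, hu, hg, h1, h2⟩ := hv
  have h3 : ∀ l', l' ≠ l → ev f φ (v l).1 * φ l (v l).2 = ev f φ u * φ l g * φ l' (f l' l e) := by
    intro l' hl'
    rw [h1]
    by_cases he : e = 1
    · subst he
      simp [top_one]
    · simp [top_ne _ _ he, ev_two hA hl'.symm]
  have h4 : ∀ l', l' ≠ l → ev f φ (v l').1 * φ l' (v l').2 = ev f φ (v l).1 * φ l (v l).2 := by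
    intro l' hl'
    rw [h3 l' hl', h2 l' hl']
    simp only [map_mul]
    rw [← mul_assoc, ev_up_of hf hA u (ev_par hf hA u) g hl'.symm]
  have h5 : ∀ l', ev f φ (v l').1 * φ l' (v l').2 = ev f φ (v l).1 * φ l (v l).2 := by
    intro l'
    by_cases hl' : l' = l
    · rw [hl']
    · exact h4 l' hl'
  rw [h5 i, h5 j]

/-- The map from chambers to flags of colour `i`. -/
def flagMap (hf : TriHyp f) (i : Fin 3)
    (v : {v : ∀ j, TriVertex G E i₀ j × G j // IsChamber f v}) :
    {y : TriVertex G E i₀ i // Valid f y} × G i :=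
  (⟨(v.1 i).1, v.2.valid hf i⟩, (v.1 i).2)

theorem flagMap_bijective (hf : TriHyp f) (hA : TriAmalgam f φ) (i : Fin 3) :
    Function.Bijective (flagMap (i₀ := i₀) hf i) := by
  constructor
  · rintro ⟨v, hv⟩ ⟨v', hv'⟩ h
    simp only [flagMap, Prod.mk.injEq, Subtype.mk.injEq] at h
    exact Subtype.ext (hv.ext hf hv' (Prod.ext h.1 h.2))
  · rintro ⟨⟨y, hy⟩, g⟩
    obtain ⟨v, hv, h⟩ := exists_isChamber_flag hf hA.gen_vertex hy g
    exact ⟨⟨v, hv⟩, by simp [flagMap, h]⟩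

theorem exists_chamberMap (hf : TriHyp f) (hA : TriAmalgam f φ) (i₀ : Fin 3) :
    ∃ c : A → ∀ j, TriVertex G E i₀ j × G j, (∀ a, IsChamber f (c a)) ∧ c 1 i₀ = (root, 1) ∧
      (∀ a i g, c (a * φ i g) i = ((c a i).1, (c a i).2 * g)) ∧ Function.Injective c := by
  let C := {v : ∀ j, TriVertex G E i₀ j × G j // IsChamber f v}
  let e (i : Fin 3) := Equiv.ofBijective _ (flagMap_bijective (i₀ := i₀) hf hA i)
  let ψ (i : Fin 3) : G i →* Equiv.Perm C := MonoidHom.mk'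
    (fun g => (e i).trans ((Equiv.prodCongr (Equiv.refl _) (Equiv.mulRight g⁻¹)).trans (e i).symm))
    (by
      intro a b
      ext1 v
      simp [Prod.map, mul_assoc])
  have hψ : ∀ i g v, (ψ i g v).1 i = ((v.1 i).1, (v.1 i).2 * g⁻¹) := by
    intro i g v
    have : e i (ψ i g v) = ((e i v).1, (e i v).2 * g⁻¹) := by
      simp [ψ, Prod.map]
    simp only [e, Equiv.ofBijective_apply, flagMap, Prod.mk.injEq, Subtype.mk.injEq] at this
    exact Prod.ext this.1 this.2
  obtain ⟨Ψ, hΨ⟩ := hA.lift (Equiv.Perm C) ψ (by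
    intro i j k hik hjk a
    ext1 v
    by_cases hij : i = j
    · subst hij; rfl
    obtain ⟨v', h1, h2, h3⟩ := v.2.rotate hf hij hik hjk a⁻¹
    rw [map_inv, ← hψ] at h2 h3
    exact Subtype.ext (((ψ i (f i k a) v).2.ext hf h1 h2.symm).trans
      (h1.ext hf (ψ j (f j k a) v).2 h3)))
  obtain ⟨v₀, hv₀, hv₀', -⟩ := exists_isChamber_base hf (y := (root : TriVertex G E i₀ i₀)) trivial
  have hmul : ∀ a i g, (Ψ (a * φ i g)⁻¹ ⟨v₀, hv₀⟩).1 i =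
      (((Ψ a⁻¹ ⟨v₀, hv₀⟩).1 i).1, ((Ψ a⁻¹ ⟨v₀, hv₀⟩).1 i).2 * g) := by
    intro a i g
    rw [mul_inv_rev, map_mul, ← map_inv, hΨ, Equiv.Perm.mul_apply, hψ, inv_inv]
  refine ⟨fun a => (Ψ a⁻¹ ⟨v₀, hv₀⟩).1, fun a => (Ψ a⁻¹ ⟨v₀, hv₀⟩).2, ?_, hmul, ?_⟩
  · simpa using hv₀'
  · have hev : ∀ a, ∀ i, ev f φ ((Ψ a⁻¹ ⟨v₀, hv₀⟩).1 i).1 * φ i ((Ψ a⁻¹ ⟨v₀, hv₀⟩).1 i).2 = a := by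
      let P : A → Prop := fun a =>
        ∀ i, ev f φ ((Ψ a⁻¹ ⟨v₀, hv₀⟩).1 i).1 * φ i ((Ψ a⁻¹ ⟨v₀, hv₀⟩).1 i).2 = a
      have h1 : P 1 := by
        intro i
        rw [(Ψ 1⁻¹ ⟨v₀, hv₀⟩).2.ev_eq hf hA i i₀]
        simp [hv₀', ev]
      have h2 : ∀ i g a, P a → P (a * φ i g) := by
        intro i g a ha j
        rw [(Ψ (a * φ i g)⁻¹ ⟨v₀, hv₀⟩).2.ev_eq hf hA j i, hmul, map_mul, ← mul_assoc, ha]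
      let K : Subgroup A :=
        { carrier := {z | ∀ a, P (a * z) ↔ P a}
          one_mem' := by simp
          mul_mem' := by
            intro x y hx hy a
            rw [← mul_assoc, hy, hx]
          inv_mem' := by
            intro x hx a
            rw [← hx]; simp }
      have hK : (⊤ : Subgroup A) ≤ K := by
        rw [← hA.gen, iSup_le_iff]
        rintro i _ ⟨g, rfl⟩ a
        refine ⟨fun h => ?_, h2 i g a⟩
        have := h2 i g⁻¹ _ h
        simpa using this
      intro a
      have := (hK (Subgroup.mem_top a) 1).2 h1
      rwa [one_mul] at this
    intro a b hab
    have h1 := hev a 0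
    have h2 := hev b 0
    have hab' : (Ψ a⁻¹ ⟨v₀, hv₀⟩).1 = (Ψ b⁻¹ ⟨v₀, hv₀⟩).1 := hab
    rw [hab'] at h1
    exact h1.symm.trans h2

theorem _root_.TriAmalgam.injective (hf : TriHyp f) (hA : TriAmalgam f φ) (i : Fin 3) :
    Function.Injective (φ i) := by
  obtain ⟨c, -, h1, h2, -⟩ := exists_chamberMap hf hA i
  intro g g' h
  have h3 := h2 1 i g
  rw [h, h2 1 i g', h1] at h3
  simpa using h3.symm

theorem chamberMap_up (hf : TriHyp f) {c : A → ∀ j, TriVertex G E i₀ j × G j}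
    (hc : ∀ a, IsChamber f (c a)) (h1 : c 1 i₀ = (root, 1))
    (h2 : ∀ a i g, c (a * φ i g) i = ((c a i).1, (c a i).2 * g)) (g : G i₀) :
    c (φ i₀ g) i₀ = (root, g) ∧ ∀ j, j ≠ i₀ → c (φ i₀ g) j = up f (root, g) j := by
  have h3 : c (φ i₀ g) i₀ = (root, g) := by
    have := h2 1 i₀ g
    rw [h1] at this
    simpa using this
  have hfar : Far f (root : TriVertex G E i₀ i₀) g := by
    intro j _ k _ _
    refine ⟨fun h => ?_, fun h => ?_⟩ <;>
    · obtain ⟨q, hq⟩ := h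
      simp at hq
  obtain ⟨v, h4, h5, h6⟩ := exists_isChamber (u := root) (by trivial) hfar 1
  rw [top_one] at h5
  obtain rfl := h4.ext hf (hc (φ i₀ g)) (h5.trans h3.symm)
  refine ⟨h3, fun j hj => ?_⟩
  rw [h6 j hj]
  simp

theorem _root_.TriAmalgam.mem_of_eq (hf : TriHyp f) (hA : TriAmalgam f φ) {i j k : Fin 3}
    (hij : i ≠ j) (hik : i ≠ k) (hjk : j ≠ k) {g : G i} {g' : G j} (h : φ i g = φ j g') :
    ∃ e : E k, g = f i k e := by
  obtain ⟨c, hc, h1, h2, -⟩ := exists_chamberMap hf hA i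
  have h3 := (chamberMap_up hf hc h1 h2 g).2 j hij.symm
  have h4 := (chamberMap_up hf hc h1 h2 1).2 j hij.symm
  have hd : ∀ g : G i, ¬ Dist2 f (root : TriVertex G E i i) g j := by
    rintro g ⟨⟨q, hq⟩, -⟩
    simp at hq
  have h5 := congrArg Prod.fst (h2 1 j g')
  rw [one_mul, ← h, h3, ← map_one (φ i), h4, up_eq_one hij hik hjk (hd _),
    up_eq_one hij hik hjk (hd _)] at h5
  simp only [one.injEq, heq_eq_eq, true_and] at h5
  have h6 := rep_mul_rem f i k g
  have h7 := rep_mul_rem f i k 1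
  refine ⟨(rem f i k 1)⁻¹ * rem f i k g, ?_⟩
  rw [map_mul, map_inv, ← eq_inv_of_mul_eq_one_left h7, ← h5, h6]

/-- The level of the vertices of colour `i` relative to a base vertex of colour `i₀`, together with
the properties of the corresponding geodesics. -/
theorem _root_.TriAmalgam.exists_level (hf : TriHyp f) (hA : TriAmalgam f φ) (i₀ : Fin 3) :
    ∃ L : Fin 3 → A → ℕ, ∀ i a, (L i a = 0 → i = i₀ ∧ a ∈ (φ i₀).range) ∧
      (0 < L i a → ∃ j k, i ≠ j ∧ i ≠ k ∧ j ≠ k ∧ ∃ g : G i, L j (a * φ i g) < L i a ∧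
        ∀ γ ∈ (φ i₀).range, ∀ g' : G i, γ * (a * φ i g) = a * φ i g * φ i g' →
          ∃ x : E k, g' = f i k x) := by
  obtain ⟨c, hc, h1, h2, hinj⟩ := exists_chamberMap hf hA i₀
  have hzero : ∀ i a, lvl (c a i).1 = 0 → i = i₀ ∧ a ∈ (φ i₀).range := by
    intro i a h
    obtain ⟨rfl, h⟩ := eq_of_lvl_eq_zero _ h
    refine ⟨rfl, (c a i₀).2, ?_⟩
    apply hinj
    refine (hc _).ext hf (hc a) (i := i₀) ?_
    rw [(chamberMap_up hf hc h1 h2 _).1]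
    exact Prod.ext h.symm rfl
  have hstep : ∀ i a, 0 < lvl (c a i).1 → ∃ j, i ≠ j ∧ ∃ g : G i,
      c (a * φ i g) i = ((c a i).1, 1) ∧ lvl (c (a * φ i g) j).1 + 1 = lvl (c a i).1 := by
    intro i a h
    have hv := (hc a).valid hf i
    obtain ⟨j, q, hij, hq⟩ := hasPar_of_lvl_pos _ hv h
    obtain ⟨v, h3, h4, h5⟩ := exists_isChamber_base hf hv
    have h6 : c (a * φ i (c a i).2⁻¹) i = ((c a i).1, 1) := by
      rw [h2]; simp
    obtain rfl := h3.ext hf (hc _) (h4.trans h6.symm)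
    refine ⟨j, hij, _, h6, ?_⟩
    rw [h5 j q hq]
    exact lvl_par _ j q hq
  have hinv : ∀ γ ∈ (φ i₀).range, ∀ n i a, lvl (c a i).1 ≤ n → lvl (c (γ * a) i).1 ≤ n := by
    intro γ hγ n
    induction n with
    | zero =>
      intro i a h
      obtain ⟨rfl, ⟨g, rfl⟩⟩ := hzero i a (Nat.le_zero.1 h)
      obtain ⟨g', rfl⟩ := hγ
      rw [← map_mul, (chamberMap_up hf hc h1 h2 _).1]
      simp [lvl]
    | succ n ih =>
      intro i a h
      by_cases h0 : lvl (c a i).1 = 0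
      · obtain ⟨rfl, ⟨g, rfl⟩⟩ := hzero i a h0
        obtain ⟨g', rfl⟩ := hγ
        rw [← map_mul, (chamberMap_up hf hc h1 h2 _).1]
        simp [lvl]
      · obtain ⟨j, hij, g, h3, h4⟩ := hstep i a (Nat.pos_of_ne_zero h0)
        have h5 := ih j (a * φ i g) (by omega)
        have h6 := (hc (γ * (a * φ i g))).lvl_le i j
        rw [← mul_assoc, h2] at h6
        rw [← mul_assoc] at h5
        exact h6.trans (by omega)
  refine ⟨fun i a => lvl (c a i).1, fun i a => ⟨hzero i a, fun h => ?_⟩⟩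
  obtain ⟨j, hij, g, h3, h4⟩ := hstep i a h
  obtain ⟨hik, hjk⟩ := third_ne hij
  refine ⟨j, _, hij, hik, hjk, g, by show lvl _ < lvl _; omega, fun γ hγ g' hg' => ?_⟩
  have h5 : c (γ * (a * φ i g)) i = ((c a i).1, g') := by
    rw [hg', h2, h3]; simp
  have h6 := hinv γ hγ _ j _ (le_refl (lvl (c (a * φ i g) j).1))
  obtain ⟨x, hx⟩ := (hc (γ * (a * φ i g))).mem_range hf hij hik hjk (by
    rw [h5]
    show _ < lvl (c a i).1
    omega)
  rw [h5] at hx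
  exact ⟨x, hx⟩

theorem _root_.TriAmalgam.link (hf : TriHyp f) (hA : TriAmalgam f φ) {i j k : Fin 3}
    (hij : i ≠ j) (hik : i ≠ k) (hjk : j ≠ k) (p p' : E i) (y y' : G i)
    (h : φ j (f j i p) * φ i y = φ i y' * φ j (f j i p')) : p = 1 ∨ y = 1 := by
  obtain ⟨c, hc, h1, h2, hinj⟩ := exists_chamberMap hf hA i
  have hroot := (chamberMap_up hf hc h1 h2 1)
  have hlvl1 : ∀ g : G i, ∀ l, l ≠ i → lvl (c (φ i g) l).1 = 1 := by
    intro g l hl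
    rw [(chamberMap_up hf hc h1 h2 g).2 l hl, lvl_up]
    rfl
  have hcomp := hA.compat j k i hij.symm hik.symm
  have hfst : ∀ a l g, (c (a * φ l g) l).1 = (c a l).1 := fun a l g => by rw [h2]
  have hlvl : ∀ g : G i, ∀ p l, l ≠ i → lvl (c (φ i g * φ j (f j i p)) l).1 = 1 := by
    intro g p l hl
    rcases eq_or_eq_or_eq hij hik hjk l with rfl | rfl | rfl
    · exact absurd rfl hl
    · rw [hfst, hlvl1 g _ hl]
    · rw [hcomp, hfst, hlvl1 g _ hl]
  have hp : ∀ l, l ≠ i → lvl (c (φ j (f j i p)) l).1 = 1 := by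
    intro l hl
    have := hlvl 1 p l hl
    rwa [map_one, one_mul] at this
  have hle := (hc (φ j (f j i p))).lvl_le i j
  rw [hp j hij.symm] at hle
  have hcases : lvl (c (φ j (f j i p)) i).1 = 0 ∨ lvl (c (φ j (f j i p)) i).1 = 1 ∨
      lvl (c (φ j (f j i p)) i).1 = 2 := by omega
  rcases hcases with h0 | h0 | h0
  · left
    obtain ⟨_, hq⟩ := eq_of_lvl_eq_zero _ h0
    have h3 : φ i (c (φ j (f j i p)) i).2 = φ j (f j i p) := by
      apply hinj
      refine (hc _).ext hf (hc _) (i := i) ?_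
      rw [(chamberMap_up hf hc h1 h2 _).1]
      exact Prod.ext hq.symm rfl
    obtain ⟨e, he⟩ := hA.mem_of_eq hf hij.symm hjk hik h3.symm
    exact (hf.disj hij.symm hjk hik he).1
  · exact absurd rfl (ne_of_lvl_eq_one _ ((hc _).valid hf i) h0)
  · right
    have key : ∀ a, (∀ l, l ≠ i → lvl (c a l).1 = 1) → lvl (c a i).1 = 2 → (c a i).2 = 1 := by
      intro a h3 h4
      obtain ⟨x, hx⟩ := (hc a).mem_range hf hij hik hjk (by rw [h4, h3 j hij.symm]; norm_num)
      obtain ⟨x', hx'⟩ := (hc a).mem_range hf hik hij hjk.symm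
        (by rw [h4, h3 k hik.symm]; norm_num)
      rw [hx]
      rw [hx] at hx'
      rw [(hf.disj hik hij hjk.symm hx').1, map_one]
    have h3 := key _ hp h0
    have h4 := key (φ j (f j i p) * φ i y) (by rw [h]; exact hlvl y' p') (by rw [hfst, h0])
    rw [h2, h3] at h4
    simpa using h4

end TriVertex

/-- The alternating product `x * y * x * ⋯` with `k` factors. -/
def altProd {G : Type*} [Group G] (k : ℕ) (x y : G) : G :=
  ((List.range k).map fun i => if i % 2 = 0 then x else y).prod

theorem altProd_succ {G : Type*} [Group G] (k : ℕ) (x y : G) :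
    altProd (k + 1) x y = altProd k x y * if k % 2 = 0 then x else y := by
  simp [altProd, List.range_succ]

theorem map_altProd {G H : Type*} [Group G] [Group H] (f : G →* H) (k : ℕ) (x y : G) :
    f (altProd k x y) = altProd k (f x) (f y) := by
  induction k with
  | zero => simp [altProd]
  | succ k ih => rw [altProd_succ, altProd_succ, map_mul, ih]; split_ifs <;> rfl

theorem braidWord_eq_altProd {S : Type*} (k : ℕ) (s t : S) :
    braidWord k s t = altProd k (FreeGroup.of s) (FreeGroup.of t) := by
  unfold braidWord altProd
  congr 2
  funext i
  split_ifs <;> rfl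

theorem altProd_mul_pow {G : Type*} [Group G] {x y τ : G} (hx : τ * x = y * τ)
    (hy : τ * y = x * τ) (k : ℕ) : altProd k x y * τ ^ k = (x * τ) ^ k := by
  induction k with
  | zero => simp [altProd]
  | succ k ih =>
    have h : ∀ k : ℕ, τ ^ k * x = (if k % 2 = 0 then x else y) * τ ^ k := by
      intro k
      induction k with
      | zero => simp
      | succ k ih =>
        rw [pow_succ', mul_assoc, ih, ← mul_assoc]
        rcases Nat.mod_two_eq_zero_or_one k with h | h
        · have h' : (k + 1) % 2 = 1 := by omega
          simp [h, h', hx, mul_assoc]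
        · have h' : (k + 1) % 2 = 0 := by omega
          simp [h, h', hy, mul_assoc]
    rw [altProd_succ, pow_succ (x * τ), ← ih, pow_succ τ, mul_assoc, ← mul_assoc _ (τ ^ k), ← h k]
    simp only [mul_assoc]

namespace ArtinGroup

variable {S : Type*} {M : S → S → ℕ∞}

/-- A homomorphism from an Artin group, given by elements satisfying the braid relations. -/
def lift {G : Type*} [Group G] (f : S → G)
    (hf : ∀ s t, s ≠ t → ∀ k : ℕ, M s t = k → altProd k (f s) (f t) = altProd k (f t) (f s)) :
    ArtinGroup M →* G :=
  PresentedGroup.toGroup (f := f) (by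
    rintro r ⟨s, t, hst, k, hk, rfl⟩
    rw [map_mul, map_inv, braidWord_eq_altProd, braidWord_eq_altProd, map_altProd, map_altProd]
    simp [hf s t hst k hk])

@[simp] theorem lift_of {G : Type*} [Group G] (f : S → G)
    (hf : ∀ s t, s ≠ t → ∀ k : ℕ, M s t = k → altProd k (f s) (f t) = altProd k (f t) (f s))
    (s : S) : lift f hf (PresentedGroup.of s : ArtinGroup M) = f s :=
  PresentedGroup.toGroup.of _

theorem altProd_of {s t : S} (hst : s ≠ t) {k : ℕ} (hk : M s t = k) :
    altProd k (PresentedGroup.of s : ArtinGroup M) (PresentedGroup.of t) =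
      altProd k (PresentedGroup.of t) (PresentedGroup.of s) := by
  have h : PresentedGroup.mk (artinRels M) (braidWord k s t * (braidWord k t s)⁻¹) = 1 :=
    PresentedGroup.one_of_mem ⟨s, t, hst, k, hk, rfl⟩
  rw [map_mul, map_inv, mul_inv_eq_one, braidWord_eq_altProd, braidWord_eq_altProd, map_altProd,
    map_altProd] at h
  exact h

/-- The homomorphism to the integers sending every generator to one. -/
def length (M : S → S → ℕ∞) : ArtinGroup M →* Multiplicative ℤ :=
  lift (fun _ => Multiplicative.ofAdd 1) fun _ _ _ _ _ => rfl

@[simp] theorem length_of (s : S) :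
    length M (PresentedGroup.of s) = Multiplicative.ofAdd 1 := lift_of _ _ s

theorem of_zpow_eq_one {s : S} {n : ℤ} (h : (PresentedGroup.of s : ArtinGroup M) ^ n = 1) :
    n = 0 := by
  simpa using congrArg (fun a => Multiplicative.toAdd (length M a)) h

end ArtinGroup

/-- The sequence of values of Chebyshev polynomials attached to a rotation of order `m`, or to a
unipotent element if `m = 0`. -/
theorem exists_chebyshev_sequence {m : ℕ} (hm : m = 0 ∨ 3 ≤ m) :
    ∃ (κ : ℝ) (s : ℤ → ℝ), 0 < κ ∧ s 0 = 0 ∧ s 1 = 1 ∧ s m = 0 ∧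
      (∀ k, s (k + 1) + s (k - 1) = κ * s k) ∧
      ∀ k, ¬ (m : ℤ) ∣ k → (0 < s k ∧ 0 ≤ s (k + 1) ∧ 0 ≤ s (k - 1)) ∨
        (s k < 0 ∧ s (k + 1) ≤ 0 ∧ s (k - 1) ≤ 0) := by
  rcases hm with rfl | hm
  · refine ⟨2, fun k => k, by norm_num, by simp, by simp, by simp, fun k => by push_cast; ring, ?_⟩
    intro k hk
    have hk : k ≠ 0 := by
      rintro rfl
      simp at hk
    rcases lt_or_gt_of_ne hk with h | h
    · right
      simp only [Int.cast_lt_zero, Int.cast_nonpos]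
      omega
    · left
      simp only [Int.cast_pos, Int.cast_nonneg_iff]
      omega
  · set θ : ℝ := Real.pi / m with hθ
    have hm0 : (0 : ℝ) < m := by positivity
    have hmθ : m * θ = Real.pi := by rw [hθ]; field_simp
    have hθ0 : 0 < θ := by positivity
    have hθ1 : θ < Real.pi / 2 := by
      have : (3 : ℝ) ≤ m := by exact_mod_cast hm
      nlinarith [Real.pi_pos]
    have hsin : 0 < Real.sin θ := Real.sin_pos_of_pos_of_lt_pi hθ0 (by linarith [Real.pi_pos])
    refine ⟨2 * Real.cos θ, fun k => Real.sin (k * θ) / Real.sin θ, ?_, by simp, ?_, ?_, ?_, ?_⟩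
    · have := Real.cos_pos_of_mem_Ioo ⟨by linarith, hθ1⟩
      positivity
    · simp [hsin.ne']
    · simp [hmθ]
    · intro k
      push_cast
      rw [add_mul, sub_mul, one_mul, Real.sin_add, Real.sin_sub]
      field_simp
      ring
    · intro k hk
      have hr0 : 0 ≤ k % m := Int.emod_nonneg _ (by omega)
      have hr1 : k % m < m := Int.emod_lt_of_pos _ (by omega)
      have hr2 : k % m ≠ 0 := fun h => hk (Int.dvd_of_emod_eq_zero h)
      set r := k % m with hr
      have key : ∀ j : ℤ, Real.sin (((k + j : ℤ) : ℝ) * θ) =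
          (-1) ^ (k / m) * Real.sin ((r + j : ℤ) * θ) := by
        intro j
        have h1 : ((k + j : ℤ) : ℝ) * θ = ((r + j : ℤ) : ℝ) * θ + (k / m : ℤ) * Real.pi := by
          have : (k : ℝ) = (r : ℝ) + m * (k / m : ℤ) := by
            exact_mod_cast (Int.emod_add_mul_ediv k m).symm
          rw [← hmθ]
          push_cast
          rw [this]
          ring
        rw [h1, Real.sin_add_int_mul_pi]
      have hnn : ∀ j : ℤ, 0 ≤ r + j → r + j ≤ m → 0 ≤ Real.sin ((r + j : ℤ) * θ) := by
        intro j h1 h2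
        apply Real.sin_nonneg_of_nonneg_of_le_pi
        · have : (0 : ℝ) ≤ (r + j : ℤ) := by exact_mod_cast h1
          positivity
        · rw [← hmθ]
          have : ((r + j : ℤ) : ℝ) ≤ m := by exact_mod_cast h2
          gcongr
      have h0 : 0 < Real.sin ((r + 0 : ℤ) * θ) := by
        apply Real.sin_pos_of_pos_of_lt_pi
        · have : (0 : ℝ) < (r + 0 : ℤ) := by exact_mod_cast (by omega)
          positivity
        · rw [← hmθ]
          have : ((r + 0 : ℤ) : ℝ) < m := by exact_mod_cast (by omega)
          gcongr
      have h1 := hnn 1 (by omega) (by omega)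
      have h2 := hnn (-1) (by omega) (by omega)
      have k0 := key 0
      have k1 := key 1
      have k2 := key (-1)
      rw [add_zero] at k0
      simp only [sub_eq_add_neg]
      rw [k0, k1, k2]
      rcases Int.even_or_odd (k / m) with h | h
      · left
        rw [h.neg_one_zpow, one_mul, one_mul, one_mul]
        exact ⟨by positivity, by positivity, by positivity⟩
      · right
        rw [h.neg_one_zpow]
        simp only [neg_one_mul, neg_div, Left.neg_neg_iff, Left.neg_nonpos_iff]
        exact ⟨by positivity, by positivity, by positivity⟩

section NormalForm

variable {Γ : Type*} [Group Γ]

/-- Products of elements `d ^ k * τ` with `k` not divisible by `m`. -/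
inductive IsTurnWord (d τ : Γ) (m : ℕ) : Γ → Prop
  | one : IsTurnWord d τ m 1
  | cons (k : ℤ) (p : Γ) (hk : ¬ (m : ℤ) ∣ k) (hp : IsTurnWord d τ m p) :
      IsTurnWord d τ m (d ^ k * τ * p)

theorem exists_turnWord {d τ : Γ} {m : ℕ} (h2 : Commute (τ ^ 2) d) (hm : Commute (d ^ m) τ)
    {w : Γ} (hw : w ∈ Subgroup.closure {d, τ}) :
    ∃ (j e e' : ℤ) (p : Γ), IsTurnWord d τ m p ∧ w = d ^ (m * j) * τ ^ e * p * τ ^ e' := by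
  have hcm : ∀ j e : ℤ, Commute (τ ^ e) (d ^ (m * j)) := fun j e => by
    rw [zpow_mul, zpow_natCast]
    exact (hm.symm.zpow_left e).zpow_right j
  have hc2 : ∀ f k : ℤ, Commute (τ ^ (2 * f)) (d ^ k) := fun f k => by
    rw [zpow_mul, ← Nat.cast_two, zpow_natCast]
    exact (h2.zpow_left f).zpow_right k
  have hτ : ∀ (i : ℤ) (y : Γ), (∃ (j e e' : ℤ) (p : Γ), IsTurnWord d τ m p ∧
      y = d ^ (m * j) * τ ^ e * p * τ ^ e') → ∃ (j e e' : ℤ) (p : Γ), IsTurnWord d τ m p ∧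
      τ ^ i * y = d ^ (m * j) * τ ^ e * p * τ ^ e' := by
    rintro i y ⟨j, e, e', p, hp, rfl⟩
    refine ⟨j, i + e, e', p, hp, ?_⟩
    simp only [← mul_assoc]
    rw [(hcm j i).eq, mul_assoc _ (τ ^ i), ← zpow_add]
  have hd : ∀ (k : ℤ) (y : Γ), (∃ (j e e' : ℤ) (p : Γ), IsTurnWord d τ m p ∧
      y = d ^ (m * j) * τ ^ e * p * τ ^ e') → ∃ (j e e' : ℤ) (p : Γ), IsTurnWord d τ m p ∧
      d ^ k * y = d ^ (m * j) * τ ^ e * p * τ ^ e' := by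
    rintro k y ⟨j, e, e', p, hp, rfl⟩
    by_cases hk : (m : ℤ) ∣ k
    · obtain ⟨i, rfl⟩ := hk
      refine ⟨i + j, e, e', p, hp, ?_⟩
      rw [mul_add, zpow_add]
      simp only [mul_assoc]
    have hsw : d ^ k * (d ^ (m * j) * τ ^ e * p * τ ^ e') =
        d ^ (m * j) * (d ^ k * τ ^ e * p * τ ^ e') := by
      simp only [← mul_assoc]
      rw [← zpow_add, ← zpow_add, add_comm]
    rw [hsw]
    obtain ⟨f, rfl | rfl⟩ := Int.even_or_odd' e
    · cases hp with
      | one =>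
        refine ⟨j, 2 * f, e' - 1, _, .cons k 1 hk .one, ?_⟩
        rw [← (hc2 f k).eq]
        simp only [mul_assoc, mul_one]
        rw [← zpow_one_add]
        simp
      | cons l p hl hp =>
        by_cases hkl : (m : ℤ) ∣ k + l
        · obtain ⟨i, hi⟩ := hkl
          refine ⟨j + i, 2 * f + 1, e', p, hp, ?_⟩
          rw [← (hc2 f k).eq, mul_add, zpow_add, ← hi, zpow_add τ, zpow_one]
          simp only [mul_assoc]
          rw [← mul_assoc (d ^ k), ← zpow_add, ← mul_assoc (τ ^ _), (hc2 f _).eq]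
          simp only [mul_assoc]
        · refine ⟨j, 2 * f, e', _, .cons _ p hkl hp, ?_⟩
          rw [← (hc2 f k).eq, zpow_add d]
          simp only [mul_assoc]
    · refine ⟨j, 2 * f, e', _, .cons k p hk hp, ?_⟩
      rw [zpow_add τ, zpow_one, ← mul_assoc (d ^ k), ← (hc2 f k).eq]
      simp only [mul_assoc]
  induction hw using Subgroup.closure_induction_left with
  | one => exact ⟨0, 0, 0, 1, .one, by simp⟩
  | mul_left x hx y _ ih =>
    rcases hx with rfl | rfl
    · simpa using hd 1 y ih
    · simpa using hτ 1 y ih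
  | inv_mul_cancel x hx y _ ih =>
    rcases hx with rfl | rfl
    · simpa using hd (-1) y ih
    · simpa using hτ (-1) y ih

theorem altProd_comm_iff {x y τ : Γ} (hx : τ * x = y * τ) (hy : τ * y = x * τ) (k : ℕ) :
    altProd k x y = altProd k y x ↔ Commute ((x * τ) ^ k) τ := by
  rw [← mul_left_inj (τ ^ k), altProd_mul_pow hx hy, altProd_mul_pow hy hx, ← hx]
  have : (τ * x) ^ k = τ * (x * τ) ^ k * τ⁻¹ := by
    rw [← conj_pow]
    simp [mul_assoc]
  rw [this, eq_mul_inv_iff_mul_eq]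
  exact Iff.rfl

end NormalForm

namespace DihedralRep

open Matrix (SpecialLinearGroup adjugate_fin_two)

/-- A matrix of order four in `SL(2, ℝ)`. -/
def turn : SpecialLinearGroup (Fin 2) ℝ := ⟨!![0, -1; 1, 0], by simp [Matrix.det_fin_two_of]⟩

/-- An upper unipotent matrix. -/
def upper (κ : ℝ) : SpecialLinearGroup (Fin 2) ℝ := ⟨!![1, κ; 0, 1], by simp [Matrix.det_fin_two_of]⟩

/-- A lower unipotent matrix. -/
def lower (κ : ℝ) : SpecialLinearGroup (Fin 2) ℝ := ⟨!![1, 0; -κ, 1], by simp [Matrix.det_fin_two_of]⟩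

theorem coe_turn : (turn : Matrix (Fin 2) (Fin 2) ℝ) = !![0, -1; 1, 0] := rfl

theorem coe_upper (κ : ℝ) : (upper κ : Matrix (Fin 2) (Fin 2) ℝ) = !![1, κ; 0, 1] := rfl

theorem coe_lower (κ : ℝ) : (lower κ : Matrix (Fin 2) (Fin 2) ℝ) = !![1, 0; -κ, 1] := rfl

theorem turn_mul_upper (κ : ℝ) : turn * upper κ = lower κ * turn := by
  ext i j
  fin_cases i <;> fin_cases j <;> simp [coe_turn, coe_upper, coe_lower, Matrix.mul_apply, Fin.sum_univ_two]

theorem turn_mul_lower (κ : ℝ) : turn * lower κ = upper κ * turn := by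
  ext i j
  fin_cases i <;> fin_cases j <;> simp [coe_turn, coe_upper, coe_lower, Matrix.mul_apply, Fin.sum_univ_two]

theorem upper_zero : upper 0 = 1 := by
  ext i j
  fin_cases i <;> fin_cases j <;> simp [coe_upper]

theorem upper_mul (κ μ : ℝ) : upper κ * upper μ = upper (κ + μ) := by
  ext i j
  fin_cases i <;> fin_cases j <;>
    simp [coe_upper, Matrix.mul_apply, Fin.sum_univ_two, add_comm]

theorem lower_zero : lower 0 = 1 := by
  ext i j
  fin_cases i <;> fin_cases j <;> simp [coe_lower]

theorem lower_mul (κ μ : ℝ) : lower κ * lower μ = lower (κ + μ) := by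
  ext i j
  fin_cases i <;> fin_cases j <;>
    simp [coe_lower, Matrix.mul_apply, Fin.sum_univ_two, add_comm]

theorem upper_inv (κ : ℝ) : (upper κ)⁻¹ = upper (-κ) := by
  rw [inv_eq_iff_mul_eq_one, upper_mul, add_neg_cancel, upper_zero]

theorem lower_inv (κ : ℝ) : (lower κ)⁻¹ = lower (-κ) := by
  rw [inv_eq_iff_mul_eq_one, lower_mul, add_neg_cancel, lower_zero]

theorem upper_zpow (κ : ℝ) (n : ℤ) : upper κ ^ n = upper (n * κ) := by
  induction n using Int.induction_on with
  | zero => simp [upper_zero]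
  | succ n ih => rw [zpow_add_one, ih, upper_mul]; congr 1; push_cast; ring
  | pred n ih => rw [zpow_sub_one, ih, upper_inv, upper_mul]; congr 1; push_cast; ring

theorem lower_zpow (κ : ℝ) (n : ℤ) : lower κ ^ n = lower (n * κ) := by
  induction n using Int.induction_on with
  | zero => simp [lower_zero]
  | succ n ih => rw [zpow_add_one, ih, lower_mul]; congr 1; push_cast; ring
  | pred n ih => rw [zpow_sub_one, ih, lower_inv, lower_mul]; congr 1; push_cast; ring

/-- The underlying matrix. -/
def toMat : SpecialLinearGroup (Fin 2) ℝ →* Matrix (Fin 2) (Fin 2) ℝ where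
  toFun x := x
  map_one' := rfl
  map_mul' _ _ := rfl

theorem toMat_injective : Function.Injective toMat := Subtype.val_injective

theorem toMat_turn : toMat turn = !![0, -1; 1, 0] := rfl

theorem toMat_upper (κ : ℝ) : toMat (upper κ) = !![1, κ; 0, 1] := rfl

/-- Positive diagonal, nonnegative off-diagonal entries, not both zero. -/
structure IsPos (B : Matrix (Fin 2) (Fin 2) ℝ) : Prop where
  h00 : 0 < B 0 0
  h11 : 0 < B 1 1
  h01 : 0 ≤ B 0 1
  h10 : 0 ≤ B 1 0
  off : 0 < B 0 1 + B 1 0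

theorem IsPos.mul {B C : Matrix (Fin 2) (Fin 2) ℝ} (hB : IsPos B) (hC : IsPos C) :
    IsPos (B * C) := by
  obtain ⟨b1, b2, b3, b4, b5⟩ := hB
  obtain ⟨c1, c2, c3, c4, c5⟩ := hC
  constructor <;> simp only [Matrix.mul_apply, Fin.sum_univ_two]
  · positivity
  · positivity
  · positivity
  · positivity
  · have h1 := mul_nonneg b1.le c3
    have h2 := mul_nonneg b2.le c4
    rcases b3.eq_or_lt with h | h
    · have : 0 < B 1 0 := by linarith
      have := mul_pos this c1
      have := mul_nonneg b3 c2.le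
      linarith
    · have := mul_pos h c2
      have := mul_nonneg b4 c1.le
      linarith

variable {κ : ℝ} {s : ℤ → ℝ} (h0 : s 0 = 0) (h1 : s 1 = 1)
  (hrec : ∀ k, s (k + 1) + s (k - 1) = κ * s k)

include h0 h1 hrec

theorem upper_mul_turn_zpow (k : ℤ) :
    toMat ((upper κ * turn) ^ k) = !![s (k + 1), -s k; s k, -s (k - 1)] := by
  induction k using Int.induction_on with
  | zero =>
    have := hrec 0
    simp only [zero_add, zero_sub, h1, h0, mul_zero] at this
    have h : s (-1) = -1 := by linarith
    ext i j
    fin_cases i <;> fin_cases j <;> simp [h0, h1, h]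
  | succ k ih =>
    have e1 := hrec (k + 1)
    have e0 := hrec k
    rw [add_sub_cancel_right] at e1
    rw [zpow_add_one, map_mul, ih, add_sub_cancel_right]
    ext i j
    fin_cases i <;> fin_cases j <;>
      simp [toMat_upper, toMat_turn, Matrix.mul_apply, Fin.sum_univ_two] <;> linarith
  | pred k ih =>
    have e1 := hrec (-k)
    have e0 := hrec (-k - 1)
    rw [sub_add_cancel] at e0
    have hinv : toMat (upper κ * turn)⁻¹ = !![0, 1; -1, κ] := by
      have : (upper κ * turn)⁻¹ = turn⁻¹ * upper (-κ) := by rw [mul_inv_rev, upper_inv]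
      have h' : toMat turn⁻¹ = !![0, 1; -1, 0] := by
        have h4 : turn⁻¹ = turn * turn * turn := by
          rw [inv_eq_iff_mul_eq_one]
          apply toMat_injective
          ext i j
          simp only [map_mul, map_one, toMat_turn]
          fin_cases i <;> fin_cases j <;> simp
        rw [h4, map_mul, map_mul, toMat_turn]
        simp
      rw [this, map_mul, h', toMat_upper]
      simp
    rw [zpow_sub_one, map_mul, ih, sub_add_cancel, hinv]
    ext i j
    fin_cases i <;> fin_cases j <;>
      simp [toMat_upper, toMat_turn, Matrix.mul_apply, Fin.sum_univ_two] <;> linarith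

theorem commute_turn {m : ℕ} (hm : s m = 0) : Commute ((upper κ * turn) ^ m) turn := by
  have e := hrec m
  have := upper_mul_turn_zpow h0 h1 hrec m
  rw [zpow_natCast] at this
  rw [hm] at this e
  apply toMat_injective
  ext i j
  rw [map_mul, map_mul, this]
  fin_cases i <;> fin_cases j <;>
    simp [toMat_turn, Matrix.mul_apply, Fin.sum_univ_two] <;> linarith

theorem isTurnWord_rep (hκ : 0 < κ) {m : ℕ}
    (hs : ∀ k, ¬ (m : ℤ) ∣ k → (0 < s k ∧ 0 ≤ s (k + 1) ∧ 0 ≤ s (k - 1)) ∨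
        (s k < 0 ∧ s (k + 1) ≤ 0 ∧ s (k - 1) ≤ 0))
    {Γ : Type*} [Group Γ] {d τ : Γ} (ρ : Γ →* SpecialLinearGroup (Fin 2) ℝ)
    (hd : ρ d = upper κ * turn) (hτ : ρ τ = turn) {p : Γ} (hp : IsTurnWord d τ m p) :
    p = 1 ∨ IsPos (toMat (ρ p)) ∨ IsPos (-(toMat (ρ p))) := by
  induction hp with
  | one => exact .inl rfl
  | cons k p hk hp ih =>
    right
    have e := hrec k
    have hb : (toMat (ρ (d ^ k * τ))) = -!![s k, s (k + 1); s (k - 1), s k] := by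
      rw [map_mul, map_zpow, hd, hτ, map_mul, upper_mul_turn_zpow h0 h1 hrec]
      ext i j
      fin_cases i <;> fin_cases j <;> simp [toMat_turn, Matrix.mul_apply, Fin.sum_univ_two]
    have hb' : IsPos (toMat (ρ (d ^ k * τ))) ∨ IsPos (-(toMat (ρ (d ^ k * τ)))) := by
      rw [hb]
      rcases hs k hk with ⟨p1, p2, p3⟩ | ⟨p1, p2, p3⟩
      · have := mul_pos hκ p1
        right
        constructor <;> simp <;> linarith
      · have := mul_neg_of_pos_of_neg hκ p1
        left
        constructor <;> simp <;> linarith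
    rcases ih with rfl | ih
    · rwa [mul_one]
    rw [map_mul, map_mul]
    rcases hb' with hb' | hb' <;> rcases ih with ih | ih
    · exact .inl (hb'.mul ih)
    · right
      rw [← mul_neg]
      exact hb'.mul ih
    · right
      rw [← neg_mul]
      exact hb'.mul ih
    · left
      rw [← neg_mul_neg]
      exact hb'.mul ih

theorem eq_of_rep_eq_one (hκ : 0 < κ) {m : ℕ} (hm : s m = 0)
    (hs : ∀ k, ¬ (m : ℤ) ∣ k → (0 < s k ∧ 0 ≤ s (k + 1) ∧ 0 ≤ s (k - 1)) ∨
        (s k < 0 ∧ s (k + 1) ≤ 0 ∧ s (k - 1) ≤ 0))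
    {Γ : Type*} [Group Γ] {d τ : Γ} (ρ : Γ →* SpecialLinearGroup (Fin 2) ℝ)
    (hd : ρ d = upper κ * turn) (hτ : ρ τ = turn) (h2 : Commute (τ ^ 2) d)
    (hmc : Commute (d ^ m) τ) {w : Γ} (hw : w ∈ Subgroup.closure {d, τ}) (hρ : ρ w = 1) :
    ∃ j e : ℤ, w = d ^ (m * j) * τ ^ e := by
  obtain ⟨j, e, e', p, hp, rfl⟩ := exists_turnWord h2 hmc hw
  rcases isTurnWord_rep h0 h1 hrec hκ hs ρ hd hτ hp with rfl | h
  · exact ⟨j, e + e', by rw [zpow_add, mul_one, mul_assoc]⟩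
  exfalso
  have hcm : Commute ((upper κ * turn) ^ (m * j : ℤ)) turn := by
    rw [zpow_mul, zpow_natCast]
    exact (commute_turn h0 h1 hrec hm).zpow_left j
  have hp' : ρ p = turn ^ (-e) * ((upper κ * turn) ^ (m * j : ℤ))⁻¹ * turn ^ (-e') := by
    rw [map_mul, map_mul, map_mul, map_zpow, map_zpow, map_zpow, hd, hτ] at hρ
    have := eq_inv_of_mul_eq_one_left hρ
    rw [zpow_neg, zpow_neg, ← this]
    group
  have hc : Commute (ρ p) turn := by
    rw [hp']
    exact (((Commute.refl turn).zpow_left _).mul_left hcm.inv_left).mul_left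
      ((Commute.refl turn).zpow_left _)
  have hc' : toMat (ρ p) 0 1 + toMat (ρ p) 1 0 = 0 := by
    have := congrArg (fun x => toMat x 0 0) hc.eq
    simp [toMat_turn, Matrix.mul_apply, Fin.sum_univ_two] at this
    rw [this, neg_add_cancel]
  rcases h with h | h
  · linarith [h.off]
  · have := h.off
    simp only [Matrix.neg_apply] at this
    linarith

end DihedralRep

/-- The mapping torus of an automorphism. -/
theorem exists_mapping_torus {A : Type v} [Group A] (σ : MulAut A) :
    ∃ (Γ : Type v) (_ : Group Γ) (ι : A →* Γ) (τ : Γ), Function.Injective ι ∧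
      (∀ x, τ * ι x = ι (σ x) * τ) ∧
      (∃ π : Γ →* Multiplicative ℤ, π τ = Multiplicative.ofAdd 1 ∧ ∀ x, π (ι x) = 1) ∧
      ∀ (G : Type) [Group G] (f : A →* G) (t : G), (∀ x, f (σ x) = t * f x * t⁻¹) →
        ∃ F : Γ →* G, (∀ x, F (ι x) = f x) ∧ F τ = t := by
  let θ := zpowersHom (MulAut A) σ
  have hθ : θ (Multiplicative.ofAdd 1) = σ := by simp [θ]
  refine ⟨A ⋊[θ] Multiplicative ℤ, inferInstance, SemidirectProduct.inl,
    SemidirectProduct.inr (Multiplicative.ofAdd 1), SemidirectProduct.inl_injective, ?_,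
    ⟨SemidirectProduct.rightHom, SemidirectProduct.rightHom_inr _,
      SemidirectProduct.rightHom_inl⟩, ?_⟩
  · intro x
    have := SemidirectProduct.inl_aut (φ := θ) (Multiplicative.ofAdd 1) x
    rw [hθ] at this
    rw [this, map_inv, inv_mul_cancel_right]
  · intro G _ f t h
    have key : ∀ g : Multiplicative ℤ,
        f.comp (θ g).toMonoidHom = (MulAut.conj (zpowersHom G t g)).toMonoidHom.comp f := by
      intro g
      obtain ⟨n, rfl⟩ := Multiplicative.ofAdd.surjective g
      have hinv : ∀ x, f (σ.symm x) = t⁻¹ * f x * t := by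
        intro x
        have := h (σ.symm x)
        rw [MulEquiv.apply_symm_apply] at this
        rw [this]
        group
      apply MonoidHom.ext
      intro x
      simp only [θ, zpowersHom_apply, MonoidHom.comp_apply, MulEquiv.coe_toMonoidHom,
        toAdd_ofAdd, MulAut.conj_apply]
      induction n using Int.induction_on generalizing x with
      | zero => simp
      | succ n ih =>
        rw [zpow_add_one, MulAut.mul_apply, ih, h, zpow_add_one]
        group
      | pred n ih =>
        rw [zpow_sub_one, MulAut.mul_apply, ih, MulAut.inv_apply, hinv, zpow_sub_one]
        group
    refine ⟨SemidirectProduct.lift f (zpowersHom G t) key, fun x => ?_, ?_⟩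
    · exact SemidirectProduct.lift_inl ..
    · rw [SemidirectProduct.lift_inr]
      simp

namespace ArtinGroup

open DihedralRep
open Matrix (SpecialLinearGroup)

section Dihedral

variable {S : Type*} {M : S → S → ℕ∞} {a b : S}

theorem dihedral_relation (hM : M a b = M b a) (hS : ∀ s, s = a ∨ s = b) {G : Type*} [Group G]
    (f : S → G) (h : altProd (M a b).toNat (f a) (f b) = altProd (M a b).toNat (f b) (f a))
    (s t : S) (hst : s ≠ t) (k : ℕ) (hk : M s t = k) :
    altProd k (f s) (f t) = altProd k (f t) (f s) := by
  rcases hS s with rfl | rfl <;> rcases hS t with rfl | rfl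
  · exact absurd rfl hst
  · simpa [hk] using h
  · rw [hM, hk] at h
    simpa using h.symm
  · exact absurd rfl hst

theorem altProd_toNat (hab : a ≠ b) :
    altProd (M a b).toNat (PresentedGroup.of a : ArtinGroup M) (PresentedGroup.of b) =
      altProd (M a b).toNat (PresentedGroup.of b) (PresentedGroup.of a) := by
  rcases eq_or_ne (M a b) ⊤ with h | h
  · simp [h, altProd]
  · exact altProd_of hab (ENat.natCast_toNat h).symm

theorem dihedral_hom_ext (hS : ∀ s, s = a ∨ s = b) {G : Type*} [Group G]
    {f g : ArtinGroup M →* G} (ha : f (PresentedGroup.of a) = g (PresentedGroup.of a))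
    (hb : f (PresentedGroup.of b) = g (PresentedGroup.of b)) : f = g := by
  apply PresentedGroup.ext
  intro x
  rcases hS x with rfl | rfl
  · exact ha
  · exact hb

theorem exists_dihedral_rep (hab : a ≠ b) (hM : M a b = M b a) (hS : ∀ s, s = a ∨ s = b)
    (hlarge : 3 ≤ M a b) :
    ∃ (κ : ℝ) (ρ : ArtinGroup M →* SpecialLinearGroup (Fin 2) ℝ), 0 < κ ∧
      ρ (PresentedGroup.of a) = upper κ ∧ ρ (PresentedGroup.of b) = lower κ ∧
      ∀ w, ρ w = 1 → length M w = 1 → w = 1 := by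
  classical
  have hm : (M a b).toNat = 0 ∨ 3 ≤ (M a b).toNat := by
    rcases eq_or_ne (M a b) ⊤ with h | h
    · simp [h]
    · right
      rw [← ENat.natCast_toNat h] at hlarge
      exact_mod_cast hlarge
  obtain ⟨κ, s, hκ, h0, h1, hsm, hrec, hs⟩ := exists_chebyshev_sequence hm
  have hcm := commute_turn h0 h1 hrec hsm
  have hrel := (altProd_comm_iff (turn_mul_upper κ) (turn_mul_lower κ) _).2 hcm
  let ρ : ArtinGroup M →* SpecialLinearGroup (Fin 2) ℝ :=
    lift (fun s => if s = a then upper κ else lower κ)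
      (dihedral_relation hM hS _ (by simpa [hab.symm] using hrel))
  let σ₀ : ArtinGroup M →* ArtinGroup M :=
    lift (fun s => if s = a then PresentedGroup.of b else PresentedGroup.of a)
      (dihedral_relation hM hS _ (by simpa [hab.symm] using (altProd_toNat hab).symm))
  have ρa : ρ (PresentedGroup.of a) = upper κ := by simp [ρ]
  have ρb : ρ (PresentedGroup.of b) = lower κ := by simp [ρ, hab.symm]
  have σa : σ₀ (PresentedGroup.of a) = PresentedGroup.of b := by simp [σ₀]
  have σb : σ₀ (PresentedGroup.of b) = PresentedGroup.of a := by simp [σ₀, hab.symm]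
  have hσ : σ₀.comp σ₀ = MonoidHom.id _ :=
    dihedral_hom_ext hS (by simp [σa, σb]) (by simp [σa, σb])
  let σ : MulAut (ArtinGroup M) := MonoidHom.toMulEquiv σ₀ σ₀ hσ hσ
  obtain ⟨Γ, _, ι, τ, hι, hτ, ⟨π, hπτ, hπι⟩, hlift⟩ := exists_mapping_torus σ
  have hσ' : ∀ x, σ x = σ₀ x := fun x => rfl
  obtain ⟨ρ', hρ', ρ'τ⟩ := hlift _ ρ turn (by
    have : ρ.comp σ₀ = (MulAut.conj turn).toMonoidHom.comp ρ := by
      apply dihedral_hom_ext hS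
      · simp [σa, ρa, ρb, turn_mul_upper]
      · simp [σb, ρa, ρb, turn_mul_lower]
    exact fun x => DFunLike.congr_fun this x)
  obtain ⟨ℓ, hℓ, hℓτ⟩ := hlift _ (length M) 1 (by
    have : (length M).comp σ₀ = length M := by
      apply dihedral_hom_ext hS
      · simp [σa]
      · simp [σb]
    intro x
    simpa [hσ'] using DFunLike.congr_fun this x)
  set x := ι (PresentedGroup.of a) with hxa
  set y := ι (PresentedGroup.of b) with hyb
  have hx : τ * x = y * τ := by rw [hτ, hσ', σa]
  have hy : τ * y = x * τ := by rw [hτ, hσ', σb]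
  have hdτ : Commute ((x * τ) ^ (M a b).toNat) τ := by
    refine (altProd_comm_iff hx hy _).1 ?_
    rw [hxa, hyb, ← map_altProd, altProd_toNat hab, map_altProd]
  have h2 : Commute (τ ^ 2) (x * τ) := by
    change τ ^ 2 * (x * τ) = x * τ * τ ^ 2
    rw [pow_two, ← mul_assoc, mul_assoc τ, hx, ← mul_assoc, hy]
    simp only [mul_assoc]
  have hmem : ∀ w : ArtinGroup M, ι w ∈ Subgroup.closure {x * τ, τ} := by
    have hτm : τ ∈ Subgroup.closure {x * τ, τ} := Subgroup.subset_closure (by simp)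
    have hdm : x * τ ∈ Subgroup.closure {x * τ, τ} := Subgroup.subset_closure (by simp)
    have ham : x ∈ Subgroup.closure {x * τ, τ} := by
      simpa using mul_mem hdm (inv_mem hτm)
    have hbm : y ∈ Subgroup.closure {x * τ, τ} := by
      have := mul_mem (mul_mem hτm ham) (inv_mem hτm)
      rw [hx] at this
      simpa using this
    intro w
    have : w ∈ Subgroup.closure (Set.range (PresentedGroup.of : S → ArtinGroup M)) := by
      rw [PresentedGroup.closure_range_of]
      trivial
    induction this using Subgroup.closure_induction with
    | mem z hz =>
      obtain ⟨z, rfl⟩ := hz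
      rcases hS z with rfl | rfl
      · exact ham
      · exact hbm
    | one => rw [map_one]; exact one_mem _
    | mul x y _ _ hx hy => rw [map_mul]; exact mul_mem hx hy
    | inv x _ hx => rw [map_inv]; exact inv_mem hx
  refine ⟨κ, ρ, hκ, ρa, ρb, fun w hw hl => ?_⟩
  obtain ⟨j, e, hje⟩ := eq_of_rep_eq_one h0 h1 hrec hκ hsm hs ρ'
    (by rw [map_mul, hρ', ρa, ρ'τ]) ρ'τ h2 hdτ (hmem w) (by rw [hρ', hw])
  have ej := congrArg (fun g => Multiplicative.toAdd (ℓ g)) hje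
  have er := congrArg (fun g => Multiplicative.toAdd (π g)) hje
  simp only [hℓ, hl, map_mul, map_zpow, hxa, hℓτ, length_of, mul_one, one_zpow, toAdd_one,
    toAdd_zpow, toAdd_ofAdd, smul_eq_mul] at ej
  simp only [hπι, map_mul, map_zpow, hxa, hπτ, one_mul, toAdd_one, toAdd_mul,
    toAdd_zpow, toAdd_ofAdd, smul_eq_mul, mul_one, ← ej, zero_add] at er
  rw [← ej, ← er, zpow_zero, zpow_zero, one_mul] at hje
  exact hι (hje.trans (map_one ι).symm)

variable (hab : a ≠ b) (hM : M a b = M b a) (hS : ∀ s, s = a ∨ s = b) (hlarge : 3 ≤ M a b)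

include hab hM hS hlarge

theorem dihedral_conj_of_conj_zpow {g : ArtinGroup M} {n : ℤ} (hn : n ≠ 0) {x y : S}
    (h : (PresentedGroup.of x : ArtinGroup M) ^ n = g * PresentedGroup.of y ^ n * g⁻¹) :
    (PresentedGroup.of x : ArtinGroup M) = g * PresentedGroup.of y * g⁻¹ := by
  obtain ⟨κ, ρ, hκ, ρa, ρb, hρ⟩ := exists_dihedral_rep hab hM hS hlarge
  rw [← inv_mul_eq_one]
  apply hρ
  · rw [map_mul, map_inv, inv_mul_eq_one]
    have key : ∀ z : S, ∃ N : Matrix (Fin 2) (Fin 2) ℝ, ∀ k : ℤ,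
        toMat (ρ (PresentedGroup.of z) ^ k) = 1 + (k : ℝ) • N := by
      intro z
      rcases hS z with rfl | rfl
      · refine ⟨!![0, κ; 0, 0], fun k => ?_⟩
        rw [ρa, upper_zpow, toMat_upper]
        ext i j
        fin_cases i <;> fin_cases j <;> simp
      · refine ⟨!![0, 0; -κ, 0], fun k => ?_⟩
        rw [ρb, lower_zpow]
        change !![1, 0; -(k * κ), 1] = _
        ext i j
        fin_cases i <;> fin_cases j <;> simp
    obtain ⟨N, hN⟩ := key x
    obtain ⟨N', hN'⟩ := key y
    have h' := congrArg (fun w => toMat (ρ w)) h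
    simp only [map_mul, map_zpow ρ, hN, hN'] at h'
    have hG : toMat (ρ g) * toMat (ρ g⁻¹) = 1 := by
      rw [← map_mul, ← map_mul, mul_inv_cancel, map_one, map_one]
    have hconj : ∀ c : ℝ, toMat (ρ g) * (1 + c • N') * toMat (ρ g⁻¹) =
        1 + c • (toMat (ρ g) * N' * toMat (ρ g⁻¹)) := by
      intro c
      rw [mul_add, add_mul, mul_one, hG, mul_smul_comm, smul_mul_assoc]
    rw [hconj, add_right_inj] at h'
    have hNN := smul_right_injective _ (show (n : ℝ) ≠ 0 by exact_mod_cast hn) h'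
    have h1 := hN 1
    have h1' := hN' 1
    rw [zpow_one, Int.cast_one] at h1 h1'
    apply toMat_injective
    simp only [map_mul]
    rw [h1, h1', hconj, hNN]
  · simp

theorem dihedral_zpow_mul_zpow {i j k l : ℤ}
    (h : (PresentedGroup.of a : ArtinGroup M) ^ i * PresentedGroup.of b ^ j =
      PresentedGroup.of b ^ k * PresentedGroup.of a ^ l) : i = 0 ∨ j = 0 := by
  obtain ⟨κ, ρ, hκ, ρa, ρb, hρ⟩ := exists_dihedral_rep hab hM hS hlarge
  have h' := congrArg (fun w => toMat (ρ w)) h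
  simp only [map_mul, map_zpow ρ, ρa, ρb, upper_zpow, lower_zpow, toMat_upper] at h'
  have h00 := congrFun (congrFun h' 0) 0
  have : (i * κ) * (j * κ) = 0 := by
    simpa [lower, toMat] using h00
  simpa [hκ.ne'] using this

end Dihedral

end ArtinGroup

section ConjSubgroup

variable {G H : Type*} [Group G] [Group H]

theorem mem_conjSubgroup {g x : G} {K : Subgroup G} :
    x ∈ conjSubgroup g K ↔ g⁻¹ * x * g ∈ K := by
  constructor
  · rintro ⟨y, hy, rfl⟩
    simpa [MulAut.conj_apply, mul_assoc] using hy
  · intro h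
    exact ⟨_, h, by simp [MulAut.conj_apply, mul_assoc]⟩

theorem conjSubgroup_one (K : Subgroup G) : conjSubgroup 1 K = K := by
  ext x
  simp [mem_conjSubgroup]

theorem conjSubgroup_mul (g h : G) (K : Subgroup G) :
    conjSubgroup (g * h) K = conjSubgroup g (conjSubgroup h K) := by
  ext x
  simp [mem_conjSubgroup, mul_assoc]

theorem conjSubgroup_inf (g : G) (K L : Subgroup G) :
    conjSubgroup g (K ⊓ L) = conjSubgroup g K ⊓ conjSubgroup g L := by
  ext x
  simp [mem_conjSubgroup, Subgroup.mem_inf]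

theorem conjSubgroup_mono (g : G) {K L : Subgroup G} (h : K ≤ L) :
    conjSubgroup g K ≤ conjSubgroup g L := fun _ hx => mem_conjSubgroup.2 (h (mem_conjSubgroup.1 hx))

theorem conjSubgroup_of_mem {g : G} {K : Subgroup G} (hg : g ∈ K) : conjSubgroup g K = K := by
  ext x
  rw [mem_conjSubgroup, K.mul_mem_cancel_right hg, K.mul_mem_cancel_left (inv_mem hg)]

theorem map_conjSubgroup (f : G →* H) (g : G) (K : Subgroup G) :
    (conjSubgroup g K).map f = conjSubgroup (f g) (K.map f) := by
  unfold conjSubgroup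
  rw [Subgroup.map_map, Subgroup.map_map]
  congr 1
  ext x
  simp [MulAut.conj_apply]

end ConjSubgroup

namespace ArtinGroup

variable {S : Type u} {M : S → S → ℕ∞}

/-- The Artin group on a subset of the generators. -/
abbrev Res (M : S → S → ℕ∞) (T : Set S) : Type u := ArtinGroup fun s t : T => M s t

/-- The natural map between Artin groups on nested subsets of the generators. -/
noncomputable def inc (M : S → S → ℕ∞) (T U : Set S) : Res M T →* Res M U := by
  classical
  exact if h : T ⊆ U then
    lift (fun s => PresentedGroup.of ⟨s, h s.2⟩) (fun s t hst k hk =>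
      altProd_of (M := fun s t : U => M s t) (fun e => hst (Subtype.ext (Subtype.mk.inj e))) hk)
  else 1

theorem inc_of {T U : Set S} (h : T ⊆ U) (s : T) :
    inc M T U (PresentedGroup.of s) = PresentedGroup.of ⟨s, h s.2⟩ := by
  unfold inc
  rw [dif_pos h, lift_of]

theorem inc_inc {T U V : Set S} (h : T ⊆ U) (h' : U ⊆ V) (g : Res M T) :
    inc M U V (inc M T U g) = inc M T V g := by
  have : (inc M U V).comp (inc M T U) = inc M T V := by
    apply PresentedGroup.ext
    intro s
    rw [MonoidHom.comp_apply, inc_of h, inc_of h', inc_of (h.trans h')]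
  exact DFunLike.congr_fun this g

theorem inc_self (T : Set S) (g : Res M T) : inc M T T g = g := by
  have : inc M T T = MonoidHom.id _ := by
    apply PresentedGroup.ext
    intro s
    rw [inc_of subset_rfl]
    rfl
  exact DFunLike.congr_fun this g

theorem map_inc_range {T U V : Set S} (h : T ⊆ U) (h' : U ⊆ V) :
    (inc M T U).range.map (inc M U V) = (inc M T V).range := by
  rw [MonoidHom.range_eq_map, Subgroup.map_map, MonoidHom.range_eq_map]
  congr 1
  ext g
  simp [inc_inc h h']

theorem inc_range_mono {T U V : Set S} (h : T ⊆ U) (h' : U ⊆ V) :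
    (inc M T V).range ≤ (inc M U V).range := by
  rintro _ ⟨g, rfl⟩
  exact ⟨inc M T U g, inc_inc h h' g⟩

theorem inc_range_self (T : Set S) : (inc M T T).range = ⊤ := by
  rw [MonoidHom.range_eq_top]
  exact fun g => ⟨g, inc_self T g⟩

theorem eq_top_of_of_mem {T : Set S} {K : Subgroup (Res M T)}
    (h : ∀ s : T, PresentedGroup.of s ∈ K) : K = ⊤ := by
  rw [eq_top_iff, ← PresentedGroup.closure_range_of, Subgroup.closure_le]
  rintro _ ⟨s, rfl⟩
  exact h s

theorem of_mem_inc_range {T U : Set S} (h : T ⊆ U) {s : U} (hs : (s : S) ∈ T) :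
    (PresentedGroup.of s : Res M U) ∈ (inc M T U).range :=
  ⟨PresentedGroup.of ⟨s, hs⟩, inc_of h _⟩

/-- A partition of a set of generators into three parts, the first two being singletons. -/
structure IsTriPartition (T : Set S) (X : Fin 3 → Set S) : Prop where
  sub : ∀ i, X i ⊆ T
  cover : ∀ x ∈ T, ∃ i, x ∈ X i
  disj : ∀ i j x, x ∈ X i → x ∈ X j → i = j
  nonempty : ∀ i, (X i).Nonempty
  sing : ∀ i, i ≠ 2 → ∃ x, X i = {x}

namespace IsTriPartition

variable {T : Set S} {X : Fin 3 → Set S}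

theorem sub_diff (h : IsTriPartition T X) {i k : Fin 3} (hik : i ≠ k) : X k ⊆ T \ X i :=
  fun x hx => ⟨h.sub k hx, fun hx' => hik (h.disj i k x hx' hx)⟩

theorem mem_or_mem (h : IsTriPartition T X) {i j k : Fin 3} (hij : i ≠ j) (hik : i ≠ k)
    (hjk : j ≠ k) {x : S} (hx : x ∈ T \ X i) : x ∈ X j ∨ x ∈ X k := by
  obtain ⟨l, hl⟩ := h.cover x hx.1
  have hli : l ≠ i := by
    rintro rfl
    exact hx.2 hl
  have : l = j ∨ l = k := by omega
  rcases this with rfl | rfl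
  · exact .inl hl
  · exact .inr hl

theorem triAmalgam (h : IsTriPartition T X) :
    TriAmalgam (fun i k => inc M (X k) (T \ X i)) (fun i => inc M (T \ X i) T) where
  compat i j k hik hjk e := by
    rw [inc_inc (h.sub_diff hik) Set.sdiff_subset, inc_inc (h.sub_diff hjk) Set.sdiff_subset]
  gen_vertex i j k hij hik hjk := by
    apply eq_top_of_of_mem
    intro s
    rcases h.mem_or_mem hij hik hjk s.2 with hs | hs
    · exact Subgroup.mem_sup_left (of_mem_inc_range (h.sub_diff hij) hs)
    · exact Subgroup.mem_sup_right (of_mem_inc_range (h.sub_diff hik) hs)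
  gen := by
    apply eq_top_of_of_mem
    intro s
    obtain ⟨l, hl⟩ := h.cover s s.2
    obtain ⟨i, hi⟩ : ∃ i, i ≠ l := exists_ne l
    exact Subgroup.mem_iSup_of_mem i
      (of_mem_inc_range Set.sdiff_subset (h.sub_diff hi hl))
  lift H _ ψ hψ := by
    choose l hl using fun s : T => h.cover s s.2
    choose i hi using fun s : T => exists_ne (l s)
    have key : ∀ (s : T) (j : Fin 3) (hj : (s : S) ∈ T \ X j),
        ψ (i s) (PresentedGroup.of ⟨s, h.sub_diff (hi s) (hl s)⟩) =
          ψ j (PresentedGroup.of ⟨s, hj⟩) := by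
      intro s j hj
      have hjl : j ≠ l s := by
        rintro rfl
        exact hj.2 (hl s)
      have := hψ (i s) j (l s) (hi s) hjl (PresentedGroup.of ⟨s, hl s⟩)
      rwa [inc_of (h.sub_diff (hi s)), inc_of (h.sub_diff hjl)] at this
    set w : T → H := fun s => ψ (i s) (PresentedGroup.of ⟨s, h.sub_diff (hi s) (hl s)⟩) with hw
    have hrel : ∀ s t : T, s ≠ t → ∀ k : ℕ, M s t = k →
        altProd k (w s) (w t) = altProd k (w t) (w s) := by
      intro s t hst k hk
      simp only [hw]
      obtain ⟨j, hj, hj'⟩ : ∃ j, j ≠ l s ∧ j ≠ l t := by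
        generalize l s = a
        generalize l t = b
        revert a b
        decide
      rw [key s j (h.sub_diff hj (hl s)), key t j (h.sub_diff hj' (hl t)), ← map_altProd,
        ← map_altProd]
      congr 1
      exact altProd_of (M := fun s t : ↑(T \ X j) => M s t)
        (fun e => hst (Subtype.ext (Subtype.mk.inj e))) hk
    refine ⟨ArtinGroup.lift (M := fun s t : T => M s t) w hrel, fun j g => ?_⟩
    have : (ArtinGroup.lift (M := fun s t : T => M s t) w hrel).comp
        (inc M (T \ X j) T) = ψ j := by
      apply PresentedGroup.ext
      intro s
      rw [MonoidHom.comp_apply, inc_of Set.sdiff_subset, lift_of]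
      exact key _ j s.2
    exact DFunLike.congr_fun this g

end IsTriPartition

end ArtinGroup

namespace ArtinGroup

variable {S : Type u} {M : S → S → ℕ∞}

/-- The properties of standard parabolic subgroups that are established simultaneously, by
induction on the number of generators. -/
structure IsGood (M : S → S → ℕ∞) (T : Set S) : Prop where
  inj : ∀ U ⊆ T, Function.Injective (inc M U T)
  inter : ∀ U ⊆ T, ∀ V ⊆ T, ∀ g g', inc M U T g = inc M V T g' →
    ∃ e, inc M (U ∩ V) T e = inc M U T g
  link : ∀ (t : S) (U : Set S), U ⊆ {t} → U ⊆ T → ∀ V ⊆ T, t ∉ V → ∀ u u' y y',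
    inc M U T u * inc M V T y = inc M V T y' * inc M U T u' →
      inc M U T u = 1 ∨ inc M V T y = 1
  par : ∀ X ⊆ T, ∀ Y ⊆ T, ∀ g : Res M T, ∃ u : Res M X, ∃ B ⊆ X,
    (inc M X T).range ⊓ conjSubgroup g (inc M Y T).range =
      conjSubgroup (inc M X T u) (inc M B T).range

section Powers

variable {T U : Set S}

theorem exists_zpow_of_subset_singleton {x : S} (hU : U ⊆ {x}) (hUT : U ⊆ T) (hx : x ∈ T)
    (g : Res M U) : ∃ n : ℤ, inc M U T g = PresentedGroup.of ⟨x, hx⟩ ^ n := by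
  have h : (Subgroup.zpowers (PresentedGroup.of ⟨x, hx⟩ : Res M T)).comap (inc M U T) = ⊤ := by
    apply eq_top_of_of_mem
    intro s
    have hs : (⟨(s : S), hUT s.2⟩ : T) = ⟨x, hx⟩ := Subtype.ext (hU s.2)
    rw [Subgroup.mem_comap, inc_of hUT, hs]
    exact Subgroup.mem_zpowers _
  have hg : g ∈ (Subgroup.zpowers (PresentedGroup.of ⟨x, hx⟩ : Res M T)).comap (inc M U T) := by
    rw [h]
    exact Subgroup.mem_top g
  obtain ⟨n, hn⟩ := Subgroup.mem_zpowers_iff.1 (Subgroup.mem_comap.1 hg)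
  exact ⟨n, hn.symm⟩

theorem eq_one_of_not_nonempty (hU : ¬ U.Nonempty) (g : Res M U) : g = 1 := by
  have : (⊥ : Subgroup (Res M U)) = ⊤ :=
    eq_top_of_of_mem fun s => (hU ⟨s, s.2⟩).elim
  exact Subgroup.mem_bot.1 (this ▸ Subgroup.mem_top g)

theorem inc_range_empty (T : Set S) : (inc M ∅ T).range = ⊥ := by
  rw [eq_bot_iff]
  rintro _ ⟨g, rfl⟩
  rw [eq_one_of_not_nonempty Set.not_nonempty_empty g, map_one]
  exact Subgroup.one_mem _

theorem injective_inc_of_subsingleton (hU : U.Subsingleton) (hUT : U ⊆ T) :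
    Function.Injective (inc M U T) := by
  rw [injective_iff_map_eq_one]
  intro g hg
  by_cases hne : U.Nonempty
  · obtain ⟨x, hx⟩ := hne
    obtain ⟨n, hn⟩ := exists_zpow_of_subset_singleton (fun y hy => hU hy hx) subset_rfl hx g
    rw [inc_self] at hn
    rw [hn, map_zpow, inc_of hUT] at hg
    rw [hn, of_zpow_eq_one hg, zpow_zero]
  · exact eq_one_of_not_nonempty hne g

theorem zpow_eq_zpow_conj {s t : S} {g : ArtinGroup M} {m n : ℤ}
    (h : (PresentedGroup.of s : ArtinGroup M) ^ n = g * PresentedGroup.of t ^ m * g⁻¹) :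
    n = m := by
  have := congrArg (fun a => Multiplicative.toAdd (length M a)) h
  simpa [length_of] using this

end Powers

section Trivial

variable {T X Y : Set S}

theorem par_of_eq_left (hY : Y ⊆ T) (g : Res M T) :
    ∃ u : Res M T, ∃ B ⊆ T,
      (inc M T T).range ⊓ conjSubgroup g (inc M Y T).range =
        conjSubgroup (inc M T T u) (inc M B T).range :=
  ⟨g, Y, hY, by rw [inc_range_self, top_inf_eq, inc_self]⟩

theorem par_of_eq_right (g : Res M T) :
    ∃ u : Res M X, ∃ B ⊆ X,
      (inc M X T).range ⊓ conjSubgroup g (inc M T T).range =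
        conjSubgroup (inc M X T u) (inc M B T).range :=
  ⟨1, X, subset_rfl, by
    rw [inc_range_self, map_one, conjSubgroup_one,
      conjSubgroup_of_mem (Subgroup.mem_top g), inf_top_eq]⟩

theorem inter_of_subset_left (h : X ⊆ Y) (hX : X ⊆ T) (g : Res M X) :
    ∃ e, inc M (X ∩ Y) T e = inc M X T g :=
  ⟨inc M X (X ∩ Y) g, inc_inc (Set.subset_inter subset_rfl h) (Set.inter_subset_left.trans hX) g⟩

theorem inter_of_subset_right (h : Y ⊆ X) (hY : Y ⊆ T) {g : Res M X} {g' : Res M Y}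
    (hg : inc M X T g = inc M Y T g') : ∃ e, inc M (X ∩ Y) T e = inc M X T g :=
  ⟨inc M Y (X ∩ Y) g', (inc_inc (Set.subset_inter h subset_rfl)
    (Set.inter_subset_right.trans hY) g').trans hg.symm⟩

end Trivial

section Small

variable {T : Set S} (hsymm : ∀ s t : S, M s t = M t s) (hlarge : ∀ s t : S, s ≠ t → 3 ≤ M s t)
  (hT : ∀ x ∈ T, ∀ z ∈ T, x ≠ z → ∀ w ∈ T, w = x ∨ w = z)

include hsymm hlarge hT

theorem zpow_mul_zpow_of_small {x z : S} (hx : x ∈ T) (hz : z ∈ T) (hxz : x ≠ z) {i j k l : ℤ}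
    (h : (PresentedGroup.of ⟨x, hx⟩ : Res M T) ^ i * PresentedGroup.of ⟨z, hz⟩ ^ j =
      PresentedGroup.of ⟨z, hz⟩ ^ k * PresentedGroup.of ⟨x, hx⟩ ^ l) : i = 0 ∨ j = 0 :=
  dihedral_zpow_mul_zpow (M := fun s t : T => M s t) (fun e => hxz (Subtype.mk.inj e))
    (hsymm x z) (fun s => (hT x hx z hz hxz s s.2).imp (fun e => Subtype.ext e)
      fun e => Subtype.ext e) (hlarge x z hxz) h

theorem isGood_of_small : IsGood M T where
  inj U hU := by
    by_cases h : T ⊆ U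
    · obtain rfl := hU.antisymm h
      intro g g' hg
      rwa [inc_self, inc_self] at hg
    · apply injective_inc_of_subsingleton _ hU
      obtain ⟨z, hz, hzU⟩ := Set.not_subset.1 h
      intro x hx y hy
      have hxz : x ≠ z := fun e => hzU (e ▸ hx)
      exact ((hT x (hU hx) z hz hxz y (hU hy)).resolve_right fun e => hzU (e ▸ hy)).symm
  inter U hU V hV g g' hg := by
    by_cases h : U ⊆ V
    · exact inter_of_subset_left h hU g
    by_cases h' : V ⊆ U
    · exact inter_of_subset_right h' hV hg
    obtain ⟨x, hxU, hxV⟩ := Set.not_subset.1 h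
    obtain ⟨z, hzV, hzU⟩ := Set.not_subset.1 h'
    have hxz : x ≠ z := fun e => hzU (e ▸ hxU)
    have hTxz := hT x (hU hxU) z (hV hzV) hxz
    obtain ⟨n, hn⟩ := exists_zpow_of_subset_singleton (x := x)
      (fun y hy => (hTxz y (hU hy)).resolve_right fun e => hzU (e ▸ hy)) hU (hU hxU) g
    obtain ⟨m, hm⟩ := exists_zpow_of_subset_singleton (x := z)
      (fun y hy => (hTxz y (hV hy)).resolve_left fun e => hxV (e ▸ hy)) hV (hV hzV) g'
    have hnm := hn.symm.trans (hg.trans hm)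
    refine ⟨1, ?_⟩
    rw [map_one]
    rcases zpow_mul_zpow_of_small hsymm hlarge hT (hU hxU) (hV hzV) hxz
      (i := n) (j := m) (k := m) (l := n) (by rw [hnm]) with rfl | rfl
    · rw [hn, zpow_zero]
    · rw [hg, hm, zpow_zero]
  link t U hUt hU V hV htV u u' y y' h := by
    by_cases hUne : U.Nonempty
    swap
    · exact .inl (by rw [eq_one_of_not_nonempty hUne u, map_one])
    by_cases hVne : V.Nonempty
    swap
    · exact .inr (by rw [eq_one_of_not_nonempty hVne y, map_one])
    obtain ⟨x, hx⟩ := hUne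
    obtain rfl : x = t := hUt hx
    obtain ⟨z, hz⟩ := hVne
    have hxz : x ≠ z := fun e => htV (e ▸ hz)
    have hVz : V ⊆ {z} := fun w hw =>
      (hT x (hU hx) z (hV hz) hxz w (hV hw)).resolve_left fun e => htV (e ▸ hw)
    obtain ⟨i, hi⟩ := exists_zpow_of_subset_singleton hUt hU (hU hx) u
    obtain ⟨l, hl⟩ := exists_zpow_of_subset_singleton hUt hU (hU hx) u'
    obtain ⟨j, hj⟩ := exists_zpow_of_subset_singleton hVz hV (hV hz) y
    obtain ⟨k, hk⟩ := exists_zpow_of_subset_singleton hVz hV (hV hz) y'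
    rw [hi, hj, hk, hl] at h
    rw [hi, hj]
    refine (zpow_mul_zpow_of_small hsymm hlarge hT (hU hx) (hV hz) hxz h).imp ?_ ?_ <;>
    · rintro rfl
      exact zpow_zero _
  par X hX Y hY g := by
    by_cases hXT : T ⊆ X
    · obtain rfl := hX.antisymm hXT
      exact par_of_eq_left hY g
    by_cases hYT : T ⊆ Y
    · obtain rfl := hY.antisymm hYT
      exact par_of_eq_right g
    by_cases hbot : (inc M X T).range ⊓ conjSubgroup g (inc M Y T).range = ⊥
    · exact ⟨1, ∅, Set.empty_subset _, by
        rw [hbot, inc_range_empty, map_one, conjSubgroup_one]⟩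
    obtain ⟨γ, ⟨⟨p, hp⟩, hγ⟩, hγ1⟩ := (Subgroup.bot_or_exists_ne_one _).resolve_left hbot
    obtain ⟨q, hq⟩ := mem_conjSubgroup.1 hγ
    have hXne : X.Nonempty := by
      by_contra hne
      rw [eq_one_of_not_nonempty hne p, map_one] at hp
      exact hγ1 hp.symm
    have hYne : Y.Nonempty := by
      by_contra hne
      rw [eq_one_of_not_nonempty hne q, map_one] at hq
      apply hγ1
      rw [mul_assoc, eq_comm, inv_mul_eq_one] at hq
      exact mul_eq_right.1 hq.symm
    obtain ⟨x, hx⟩ := hXne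
    obtain ⟨y, hy⟩ := hYne
    obtain ⟨z, hz, hzX⟩ := Set.not_subset.1 hXT
    obtain ⟨w, hw, hwY⟩ := Set.not_subset.1 hYT
    have hxz : x ≠ z := fun e => hzX (e ▸ hx)
    have hyw : y ≠ w := fun e => hwY (e ▸ hy)
    have hXx : X ⊆ {x} := fun v hv =>
      (hT x (hX hx) z hz hxz v (hX hv)).resolve_right fun e => hzX (e ▸ hv)
    have hYy : Y ⊆ {y} := fun v hv =>
      (hT y (hY hy) w hw hyw v (hY hv)).resolve_right fun e => hwY (e ▸ hv)
    obtain ⟨n, hn⟩ := exists_zpow_of_subset_singleton hXx hX (hX hx) p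
    obtain ⟨m, hm⟩ := exists_zpow_of_subset_singleton hYy hY (hY hy) q
    have hγn := hp.symm.trans hn
    have key : (PresentedGroup.of ⟨x, hX hx⟩ : Res M T) ^ n =
        g * PresentedGroup.of ⟨y, hY hy⟩ ^ m * g⁻¹ := by
      rw [← hγn, ← hm, hq]
      group
    obtain rfl := zpow_eq_zpow_conj (M := fun s t : T => M s t) key
    have hn0 : n ≠ 0 := by
      rintro rfl
      exact hγ1 (hγn.trans (zpow_zero _))
    have hconj := dihedral_conj_of_conj_zpow (M := fun s t : T => M s t)
      (a := ⟨x, hX hx⟩) (b := ⟨z, hz⟩) (fun e => hxz (Subtype.mk.inj e))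
      (hsymm x z) (fun s => (hT x (hX hx) z hz hxz s s.2).imp (fun e => Subtype.ext e)
        fun e => Subtype.ext e) (hlarge x z hxz) hn0 key
    refine ⟨1, X, subset_rfl, ?_⟩
    rw [map_one, conjSubgroup_one, inf_eq_left]
    rintro _ ⟨r, rfl⟩
    obtain ⟨k, hk⟩ := exists_zpow_of_subset_singleton hXx hX (hX hx) r
    rw [hk]
    apply Subgroup.zpow_mem
    rw [hconj, mem_conjSubgroup]
    have : (PresentedGroup.of ⟨y, hY hy⟩ : Res M T) ∈ (inc M Y T).range :=
      of_mem_inc_range hY hy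
    convert this using 1
    group

end Small

end ArtinGroup

namespace ArtinGroup

variable {S : Type u} {M : S → S → ℕ∞}

theorem isTriPartition_of_ne {T : Set S}
    (hT : ∀ s t : S, ∃ x ∈ T, x ≠ s ∧ x ≠ t) {s t : S} (hs : s ∈ T) (ht : t ∈ T) (hst : s ≠ t) :
    IsTriPartition T ![{s}, {t}, T \ {s, t}] where
  sub i := by
    fin_cases i
    · simpa using hs
    · simpa using ht
    · exact Set.sdiff_subset
  cover x hx := by
    by_cases h : x = s
    · exact ⟨0, h⟩
    by_cases h' : x = t
    · exact ⟨1, h'⟩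
    exact ⟨2, hx, by simp [h, h']⟩
  disj i j x hi hj := by
    fin_cases i <;> fin_cases j <;> simp_all
  nonempty i := by
    obtain ⟨x, hx, hxs, hxt⟩ := hT s t
    fin_cases i
    · exact ⟨s, rfl⟩
    · exact ⟨t, rfl⟩
    · exact ⟨x, hx, by simp [hxs, hxt]⟩
  sing i hi := by
    fin_cases i
    · exact ⟨s, rfl⟩
    · exact ⟨t, rfl⟩
    · exact absurd rfl hi

namespace IsTriPartition

variable {T : Set S} {X : Fin 3 → Set S}

theorem diff_ssubset (h : IsTriPartition T X) (i : Fin 3) : T \ X i ⊂ T := by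
  obtain ⟨x, hx⟩ := h.nonempty i
  exact ⟨Set.sdiff_subset, fun h' => (h' (h.sub i hx)).2 hx⟩

theorem part_ssubset (h : IsTriPartition T X) (i : Fin 3) : X i ⊂ T := by
  obtain ⟨j, hj⟩ := exists_ne i
  obtain ⟨x, hx⟩ := h.nonempty j
  exact ⟨h.sub i, fun h' => hj (h.disj j i x hx (h' (h.sub j hx)))⟩

theorem triHyp (h : IsTriPartition T X) (hG : ∀ i, IsGood M (T \ X i)) :
    TriHyp (fun i k => inc M (X k) (T \ X i)) where
  inj i k hik := (hG i).inj _ (h.sub_diff hik)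
  link i j k hij hik hjk p p' q q' e := by
    have key : ∀ j k : Fin 3, i ≠ j → i ≠ k → j ≠ k → j ≠ 2 → ∀ (p p' : Res M (X j))
        (q q' : Res M (X k)),
        inc M (X j) (T \ X i) p * inc M (X k) (T \ X i) q =
          inc M (X k) (T \ X i) q' * inc M (X j) (T \ X i) p' → p = 1 ∨ q = 1 := by
      intro j k hij hik hjk hj p p' q q' e
      obtain ⟨x, hx⟩ := h.sing j hj
      have hxk : x ∉ X k := fun hk => hjk (h.disj j k x (hx ▸ rfl) hk)
      refine ((hG i).link x (X j) hx.subset (h.sub_diff hij) (X k) (h.sub_diff hik) hxk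
        p p' q q' e).imp (fun e => ?_) fun e => ?_
      · exact (hG i).inj _ (h.sub_diff hij) (e.trans (map_one _).symm)
      · exact (hG i).inj _ (h.sub_diff hik) (e.trans (map_one _).symm)
    by_cases hj : j = 2
    · have hk : k ≠ 2 := fun hk => hjk (hj.trans hk.symm)
      have := key k j hik hij hjk.symm hk q⁻¹ q'⁻¹ p⁻¹ p'⁻¹ (by
        have := congrArg (·⁻¹) e
        simpa using this)
      simpa [or_comm] using this
    · exact key j k hij hik hjk hj p p' q q' e

end IsTriPartition

/-- Intersections of parabolic subgroups of a standard parabolic subgroup, seen in a larger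
group. -/
theorem IsGood.par_map {T W : Set S} (hG : IsGood M W) (hinj : Function.Injective (inc M W T))
    (hWT : W ⊆ T) {X Y : Set S} (hX : X ⊆ W) (hY : Y ⊆ W) (g : Res M W) :
    ∃ u : Res M X, ∃ B ⊆ X,
      (inc M X T).range ⊓ conjSubgroup (inc M W T g) (inc M Y T).range =
        conjSubgroup (inc M X T u) (inc M B T).range := by
  obtain ⟨u, B, hB, h⟩ := hG.par X hX Y hY g
  refine ⟨u, B, hB, ?_⟩
  have := congrArg (Subgroup.map (inc M W T)) h
  rwa [Subgroup.map_inf _ _ _ hinj, map_conjSubgroup, map_conjSubgroup, map_inc_range hX hWT,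
    map_inc_range hY hWT, map_inc_range (hB.trans hX) hWT, inc_inc hX hWT] at this

namespace IsTriPartition

variable {T : Set S} {X : Fin 3 → Set S}

theorem exists_inf_conj_eq (h : IsTriPartition T X) (hG : ∀ i, IsGood M (T \ X i))
    (i₀ : Fin 3) {Y : Set S} (hY : Y ⊆ T \ X i₀) (i : Fin 3) (a : Res M T) :
    ∃ u : Res M (T \ X i), ∃ B ⊆ T \ X i,
      (inc M Y T).range ⊓ conjSubgroup a (inc M (T \ X i) T).range =
        conjSubgroup (a * inc M (T \ X i) T u) (inc M B T).range := by
  have hf := h.triHyp hG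
  have hA := h.triAmalgam (M := M)
  obtain ⟨L, hL⟩ := TriAmalgam.exists_level hf hA i₀
  generalize hn : L i a = n
  induction n using Nat.strong_induction_on generalizing i a with
  | _ n ih =>
  rcases Nat.eq_zero_or_pos n with rfl | hpos
  · obtain ⟨rfl, u, rfl⟩ := (hL i a).1 hn
    refine ⟨u⁻¹, Y, hY, ?_⟩
    rw [map_inv, mul_inv_cancel, conjSubgroup_one, conjSubgroup_of_mem (MonoidHom.mem_range.2 ⟨u, rfl⟩), inf_eq_left]
    exact inc_range_mono hY Set.sdiff_subset
  · obtain ⟨j, k, hij, hik, hjk, g, hlt, hfix⟩ := (hL i a).2 (hn ▸ hpos)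
    set a' := a * inc M (T \ X i) T g with ha'
    obtain ⟨v, B, hB, hvB⟩ := ih _ (hn ▸ hlt) j a' rfl
    obtain ⟨w, C, hC, hwC⟩ := (hG j).par_map (TriAmalgam.injective hf hA j) Set.sdiff_subset
      (h.sub_diff hjk) hB v
    refine ⟨g * inc M (X k) (T \ X i) w, C, hC.trans (h.sub_diff hik), ?_⟩
    have h1 : (inc M Y T).range ⊓ conjSubgroup a (inc M (T \ X i) T).range =
        (inc M Y T).range ⊓ conjSubgroup a' (inc M (X k) T).range := by
      have : conjSubgroup a (inc M (T \ X i) T).range =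
          conjSubgroup a' (inc M (T \ X i) T).range := by
        rw [ha', conjSubgroup_mul, conjSubgroup_of_mem (MonoidHom.mem_range.2 ⟨g, rfl⟩)]
      rw [this]
      apply le_antisymm
      · rintro γ ⟨hγ, hγ'⟩
        refine ⟨hγ, ?_⟩
        obtain ⟨g', hg'⟩ := mem_conjSubgroup.1 hγ'
        obtain ⟨x, rfl⟩ := hfix γ (inc_range_mono hY Set.sdiff_subset hγ) g' (by
          rw [hg']
          group)
        exact mem_conjSubgroup.2 ⟨x, by rw [← hg', inc_inc (h.sub_diff hik) Set.sdiff_subset]⟩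
      · exact inf_le_inf_left _
          (conjSubgroup_mono _ (inc_range_mono (h.sub_diff hik) Set.sdiff_subset))
    have h2 : conjSubgroup a' (inc M (X k) T).range ≤
        conjSubgroup a' (inc M (T \ X j) T).range :=
      conjSubgroup_mono _ (inc_range_mono (h.sub_diff hjk) Set.sdiff_subset)
    rw [h1, ← inf_eq_right.2 h2, ← inf_assoc, hvB, conjSubgroup_mul, ← conjSubgroup_inf,
      inf_comm, hwC, ← conjSubgroup_mul, map_mul, inc_inc (h.sub_diff hik) Set.sdiff_subset,
      ← mul_assoc]

theorem par (h : IsTriPartition T X) (hG : ∀ i, IsGood M (T \ X i)) {i j : Fin 3}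
    {Y Z : Set S} (hY : Y ⊆ T \ X i) (hZ : Z ⊆ T \ X j) (g : Res M T) :
    ∃ u : Res M Y, ∃ B ⊆ Y, (inc M Y T).range ⊓ conjSubgroup g (inc M Z T).range =
      conjSubgroup (inc M Y T u) (inc M B T).range := by
  obtain ⟨u, B, hB, huB⟩ := h.exists_inf_conj_eq hG j hZ i g⁻¹
  obtain ⟨v, C, hC, hvC⟩ := (hG i).par_map
    (TriAmalgam.injective (h.triHyp hG) (h.triAmalgam (M := M)) i) Set.sdiff_subset hY hB u
  refine ⟨v, C, hC, ?_⟩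
  have := congrArg (conjSubgroup g) huB
  rw [conjSubgroup_inf, ← conjSubgroup_mul, mul_inv_cancel, conjSubgroup_one,
    ← conjSubgroup_mul, mul_inv_cancel_left] at this
  rw [← hvC, ← this, inf_comm (conjSubgroup g _), ← inf_assoc,
    inf_eq_left.2 (inc_range_mono hY Set.sdiff_subset)]

end IsTriPartition

theorem isGood_of_ssubset {T : Set S} (hT : ∀ s t : S, ∃ x ∈ T, x ≠ s ∧ x ≠ t)
    (IH : ∀ U ⊂ T, IsGood M U) : IsGood M T where
  inj U hU := by
    by_cases h : T ⊆ U
    · obtain rfl := hU.antisymm h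
      intro g g' hg
      rwa [inc_self, inc_self] at hg
    obtain ⟨s, hs, hsU⟩ := Set.not_subset.1 h
    obtain ⟨t, ht, hts, -⟩ := hT s s
    have hX := isTriPartition_of_ne hT hs ht hts.symm
    have hG := fun i => IH _ (hX.diff_ssubset i)
    have hU0 : U ⊆ T \ {s} := fun x hx => ⟨hU hx, fun e => hsU (e ▸ hx)⟩
    intro g g' hg
    rw [← inc_inc hU0 Set.sdiff_subset, ← inc_inc hU0 Set.sdiff_subset g'] at hg
    exact (hG 0).inj U hU0
      (TriAmalgam.injective (hX.triHyp hG) (hX.triAmalgam (M := M)) 0 hg)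
  inter U hU V hV g g' hg := by
    by_cases h : U ⊆ V
    · exact inter_of_subset_left h hU g
    by_cases h' : V ⊆ U
    · exact inter_of_subset_right h' hV hg
    obtain ⟨t, htU, htV⟩ := Set.not_subset.1 h
    obtain ⟨s, hsV, hsU⟩ := Set.not_subset.1 h'
    have hst : s ≠ t := fun e => hsU (e ▸ htU)
    have hX := isTriPartition_of_ne hT (hV hsV) (hU htU) hst
    have hG := fun i => IH _ (hX.diff_ssubset i)
    have hf := hX.triHyp hG
    have hA := hX.triAmalgam (M := M)
    have hU0 : U ⊆ T \ {s} := fun x hx => ⟨hU hx, fun e => hsU (e ▸ hx)⟩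
    have hV1 : V ⊆ T \ {t} := fun x hx => ⟨hV hx, fun e => htV (e ▸ hx)⟩
    set W : Set S := T \ {s, t} with hW
    have hWT : W ⊂ T := hX.part_ssubset 2
    have hW0 : W ⊆ T \ {s} := hX.sub_diff (i := 0) (k := 2) (by decide)
    have hW1 : W ⊆ T \ {t} := hX.sub_diff (i := 1) (k := 2) (by decide)
    rw [← inc_inc hU0 Set.sdiff_subset, ← inc_inc hV1 Set.sdiff_subset g'] at hg
    obtain ⟨e, he⟩ : ∃ e : Res M W, inc M U (T \ {s}) g = inc M W (T \ {s}) e :=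
      TriAmalgam.mem_of_eq hf hA (i := 0) (j := 1) (k := 2) (by decide) (by decide) (by decide) hg
    have he' : inc M V (T \ {t}) g' = inc M W (T \ {t}) e := by
      apply TriAmalgam.injective hf hA 1
      refine hg.symm.trans ?_
      rw [he]
      exact hA.compat 0 1 2 (by decide) (by decide) e
    obtain ⟨p, hp⟩ := (hG 0).inter W hW0 U hU0 e g he.symm
    obtain ⟨q, hq⟩ := (hG 1).inter W hW1 V hV1 e g' he'.symm
    have hp' : inc M (W ∩ U) W p = e := by
      apply (hG 0).inj W hW0
      exact (inc_inc Set.inter_subset_left hW0 p).trans hp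
    have hq' : inc M (W ∩ V) W q = e := by
      apply (hG 1).inj W hW1
      exact (inc_inc Set.inter_subset_left hW1 q).trans hq
    obtain ⟨r, hr⟩ := (IH W hWT).inter (W ∩ U) Set.inter_subset_left (W ∩ V)
      Set.inter_subset_left p q (hp'.trans hq'.symm)
    refine ⟨inc M (W ∩ U ∩ (W ∩ V)) (U ∩ V) r, ?_⟩
    rw [inc_inc (Set.inter_subset_inter Set.inter_subset_right Set.inter_subset_right)
      (Set.inter_subset_left.trans hU), ← inc_inc (Set.inter_subset_left.trans
      Set.inter_subset_left) hWT.subset, hr, hp', ← inc_inc hU0 Set.sdiff_subset, he,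
      inc_inc hW0 Set.sdiff_subset]
  link t U hUt hU V hV htV u u' y y' h := by
    by_cases hUne : U.Nonempty
    swap
    · exact .inl (by rw [eq_one_of_not_nonempty hUne u, map_one])
    obtain ⟨x, hx⟩ := hUne
    obtain rfl : x = t := hUt hx
    obtain ⟨t, ht, hts, -⟩ := hT x x
    have hX := isTriPartition_of_ne hT (hU hx) ht hts.symm
    have hG := fun i => IH _ (hX.diff_ssubset i)
    have hf := hX.triHyp hG
    have hA := hX.triAmalgam (M := M)
    have hV0 : V ⊆ T \ {x} := fun v hv => ⟨hV hv, fun e => htV (e ▸ hv)⟩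
    have hx1 : {x} ⊆ T \ {t} := hX.sub_diff (i := 1) (k := 0) (by decide)
    have hU1 : ∀ w : Res M U, inc M (T \ {t}) T (inc M {x} (T \ {t}) (inc M U {x} w)) =
        inc M U T w := fun w => by
      rw [inc_inc hx1 Set.sdiff_subset, inc_inc hUt (hx1.trans Set.sdiff_subset)]
    have hV1 : ∀ w : Res M V, inc M (T \ {x}) T (inc M V (T \ {x}) w) = inc M V T w :=
      fun w => inc_inc hV0 Set.sdiff_subset w
    refine (TriAmalgam.link hf hA (i := 0) (j := 1) (k := 2) (by decide) (by decide) (by decide)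
      (inc M U {x} u) (inc M U {x} u') (inc M V (T \ {x}) y) (inc M V (T \ {x}) y') ?_).imp
      (fun e => ?_) fun e => ?_
    · have := h
      rwa [← hU1, ← hU1 u', ← hV1, ← hV1 y'] at this
    · have e' : inc M U {x} u = 1 := e
      rw [← hU1, e', map_one, map_one]
    · have e' : inc M V (T \ {x}) y = 1 := e
      rw [← hV1, e', map_one]
  par X hX Y hY g := by
    by_cases hXT : T ⊆ X
    · obtain rfl := hX.antisymm hXT
      exact par_of_eq_left hY g
    by_cases hYT : T ⊆ Y
    · obtain rfl := hY.antisymm hYT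
      exact par_of_eq_right g
    obtain ⟨s, hs, hsX⟩ := Set.not_subset.1 hXT
    obtain ⟨t, ht, htY⟩ := Set.not_subset.1 hYT
    have hX0 : X ⊆ T \ {s} := fun x hx => ⟨hX hx, fun e => hsX (e ▸ hx)⟩
    have hY1 : Y ⊆ T \ {t} := fun x hx => ⟨hY hx, fun e => htY (e ▸ hx)⟩
    by_cases hst : s = t
    · subst hst
      obtain ⟨t, ht, hts, -⟩ := hT s s
      have hP := isTriPartition_of_ne hT hs ht hts.symm
      exact hP.par (fun i => IH _ (hP.diff_ssubset i)) (i := 0) (j := 0) hX0 hY1 g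
    · have hP := isTriPartition_of_ne hT hs ht hst
      exact hP.par (fun i => IH _ (hP.diff_ssubset i)) (i := 0) (j := 1) hX0 hY1 g

theorem isGood_of_finite [Finite S] (hsymm : ∀ s t : S, M s t = M t s)
    (hlarge : ∀ s t : S, s ≠ t → 3 ≤ M s t) (T : Set S) : IsGood M T := by
  induction T using WellFoundedLT.induction with
  | _ T IH =>
  by_cases hT : ∀ s t : S, ∃ x ∈ T, x ≠ s ∧ x ≠ t
  · exact isGood_of_ssubset hT IH
  · push Not at hT
    obtain ⟨s, t, hst⟩ := hT
    apply isGood_of_small hsymm hlarge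
    intro x hx z hz hxz w hw
    have h1 := hst x hx
    have h2 := hst z hz
    have h3 := hst w hw
    by_cases x = s <;> by_cases z = s <;> by_cases w = s <;> simp_all

theorem map_range_inc_univ (M : S → S → ℕ∞) :
    ∃ e : Res M Set.univ ≃* ArtinGroup M, ∀ X : Set S,
      (inc M X Set.univ).range.map e.toMonoidHom = StandardParabolic M X := by
  let ι : Res M Set.univ →* ArtinGroup M := lift (fun s => PresentedGroup.of (s : S))
    fun s t hst k hk => altProd_of (M := M) (fun e => hst (Subtype.ext e)) hk
  let κ : ArtinGroup M →* Res M Set.univ :=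
    lift (fun s => PresentedGroup.of (⟨s, Set.mem_univ s⟩ : (Set.univ : Set S)))
      fun s t hst k hk => altProd_of (M := fun s t : (Set.univ : Set S) => M s t)
        (fun e => hst (Subtype.mk.inj e)) hk
  have hικ : ι.comp κ = MonoidHom.id _ := by
    apply PresentedGroup.ext
    intro s
    simp only [ι, κ, MonoidHom.comp_apply, lift_of, MonoidHom.id_apply]
  have hκι : κ.comp ι = MonoidHom.id _ := by
    apply PresentedGroup.ext
    intro s
    simp only [ι, κ, MonoidHom.comp_apply, lift_of, MonoidHom.id_apply]
  refine ⟨MonoidHom.toMulEquiv ι κ hκι hικ, fun X => ?_⟩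
  change (inc M X Set.univ).range.map ι = _
  rw [MonoidHom.range_eq_map, ← PresentedGroup.closure_range_of, Subgroup.map_map,
    MonoidHom.map_closure]
  unfold StandardParabolic
  congr 1
  ext g
  constructor
  · rintro ⟨_, ⟨s, rfl⟩, rfl⟩
    exact ⟨s, s.2, by
      rw [MonoidHom.comp_apply, inc_of (Set.subset_univ X)]
      simp only [ι, lift_of]⟩
  · rintro ⟨s, hs, rfl⟩
    exact ⟨_, ⟨⟨s, hs⟩, rfl⟩, by
      rw [MonoidHom.comp_apply, inc_of (Set.subset_univ X)]
      simp only [ι, lift_of]⟩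

theorem exists_inf_conjSubgroup_eq [Finite S] (hsymm : ∀ s t : S, M s t = M t s)
    (hlarge : ∀ s t : S, s ≠ t → 3 ≤ M s t) (X Y : Set S) (g : ArtinGroup M) :
    ∃ (u : ArtinGroup M) (B : Set S),
      StandardParabolic M X ⊓ conjSubgroup g (StandardParabolic M Y) =
        conjSubgroup u (StandardParabolic M B) := by
  obtain ⟨e, he⟩ := map_range_inc_univ M
  obtain ⟨u, B, -, h⟩ := (isGood_of_finite hsymm hlarge Set.univ).par X (Set.subset_univ X) Y
    (Set.subset_univ Y) (e.symm g)
  have h' := congrArg (Subgroup.map e.toMonoidHom) h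
  rw [Subgroup.map_inf _ _ _ e.injective, map_conjSubgroup, map_conjSubgroup, he, he, he] at h'
  refine ⟨_, B, .trans ?_ h'⟩
  congr 2
  exact (e.apply_symm_apply g).symm

end ArtinGroup

/-- In a large-type Artin group, the intersection of two parabolic subgroups
is again a parabolic subgroup. -/
theorem intersection_of_two_parabolics {S : Type*} [Finite S] (M : S → S → ℕ∞)
    (hsymm : ∀ s t : S, M s t = M t s)
    (hlarge : ∀ s t : S, s ≠ t → 3 ≤ M s t)
    (P₁ P₂ : Subgroup (ArtinGroup M))
    (h₁ : IsParabolic M P₁) (h₂ : IsParabolic M P₂) :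
    IsParabolic M (P₁ ⊓ P₂) := by
  obtain ⟨g, X, rfl⟩ := h₁
  obtain ⟨h, Y, rfl⟩ := h₂
  obtain ⟨u, B, hB⟩ :=
    ArtinGroup.exists_inf_conjSubgroup_eq hsymm hlarge X Y (g⁻¹ * h)
  refine ⟨g * u, B, ?_⟩
  rw [conjSubgroup_mul, ← hB, conjSubgroup_inf, ← conjSubgroup_mul, mul_inv_cancel_left]
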